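/- Let p ≥ 2, α = p−1 and θ ≥ 0 with k₀ = p−1, and suppose σ_* < μ_{α,θ}. Then the function ν(σ) = ((p−1)!/σ^{p−1}) · TMC(σ,α,θ) is strictly increasing on (σ_*, μ_{α,θ}); moreover (setting TMC(0,α,θ) = 0) one has TMC(σ,α,θ) = σ^{p−1}/(p−1)! for all σ ∈ [0, σ_*], TMC(σ,α,θ) > σ^{p−1}/(p−1)! for all σ ∈ (σ_*, μ_{α,θ}), and consequently σ_* = inf{σ ∈ (0,μ_{α,θ}) : TMC(σ,α,θ) > σ^{p−1}/(p−1)!}. -/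

import Mathlib

open MeasureTheory Real Filter ENNReal

/-- The fractional-dimension spherical volume constant `ω_θ = 2π^((θ+1)/2)/Γ((θ+1)/2)`. -/
noncomputable def omegaW (θ : ℝ) : ℝ := 2 * Real.pi ^ ((θ + 1) / 2) / Real.Gamma ((θ + 1) / 2)

/-- Weighted integral `∫₀^∞ f dλ_θ = ω_θ ∫₀^∞ f(r) r^θ dr` (for nonnegative integrands,
valued in `ℝ≥0∞`). -/
noncomputable def wInt (θ : ℝ) (f : ℝ → ℝ) : ℝ≥0∞ :=
  ENNReal.ofReal (omegaW θ) *
    ∫⁻ r in Set.Ioi (0 : ℝ), ENNReal.ofReal (f r) * ENNReal.ofReal (r ^ θ)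

/-- The weighted Lebesgue norm `‖u‖_{L^q_θ}` (valued in `ℝ≥0∞`). -/
noncomputable def wNorm (θ q : ℝ) (u : ℝ → ℝ) : ℝ≥0∞ :=
  (wInt θ fun r => |u r| ^ q) ^ (1 / q)

/-- Membership in the weighted Sobolev space `X = X^{1,p}_∞(α,θ)`:
`u` is locally absolutely continuous on `(0,∞)` with a.e. derivative `u'`
(expressed through the fundamental theorem of calculus on compact subintervals),
`u(r) → 0` as `r → ∞`, `‖u‖_{L^p_θ} < ∞` and `‖u'‖_{L^p_α} < ∞`. -/
structure MemX (p α θ : ℝ) (u u' : ℝ → ℝ) : Prop where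
  ftc_int : ∀ a b : ℝ, 0 < a → a ≤ b → IntervalIntegrable u' MeasureTheory.volume a b
  ftc : ∀ a b : ℝ, 0 < a → a ≤ b → u b - u a = ∫ t in a..b, u' t
  lim_zero : Filter.Tendsto u Filter.atTop (nhds 0)
  fin_u : wNorm θ p u < ⊤
  fin_u' : wNorm α p u' < ⊤

/-- Full norm on `X`: `‖u‖ = (‖u‖_{L^p_θ}^p + ‖u'‖_{L^p_α}^p)^{1/p}`. -/
noncomputable def Xnorm (p α θ : ℝ) (u u' : ℝ → ℝ) : ℝ≥0∞ :=
  ((wNorm θ p u) ^ p + (wNorm α p u') ^ p) ^ (1 / p)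

/-- The truncated exponential `φ_p(t) = Σ_{j ∈ ℕ, j ≥ p-1} t^j / j!`. -/
noncomputable def phiP (p t : ℝ) : ℝ :=
  ∑' j : ℕ, if p - 1 ≤ (j : ℝ) then t ^ j / (Nat.factorial j : ℝ) else 0

/-- The critical constant `μ_{α,θ} = (θ+1) ω_α^{1/α}`. -/
noncomputable def muC (α θ : ℝ) : ℝ := (θ + 1) * (omegaW α) ^ (1 / α)

/-- The Trudinger–Moser functional `∫₀^∞ φ_p(μ |u|^{p/(p-1)}) dλ_θ`. -/
noncomputable def TMfunc (p θ μ : ℝ) (u : ℝ → ℝ) : ℝ≥0∞ :=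
  wInt θ fun r => phiP p (μ * |u r| ^ (p / (p - 1)))

/-- The subcritical Trudinger–Moser supremum
`TMSC(μ,α,θ) = sup { ‖u‖_{L^p_θ}^{-p} ∫₀^∞ φ_p(μ|u|^{p/(p-1)}) dλ_θ : u ∈ X, u ≠ 0, ‖u'‖_{L^p_α} ≤ 1 }`. -/
noncomputable def TMSC (p α θ μ : ℝ) : ℝ≥0∞ :=
  ⨆ (u : ℝ → ℝ) (u' : ℝ → ℝ) (_ : MemX p α θ u u') (_ : u ≠ 0)
    (_ : wNorm α p u' ≤ 1), (wNorm θ p u) ^ (-p) * TMfunc p θ μ u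

/-- The critical Trudinger–Moser supremum
`TMC(σ,α,θ) = sup { ∫₀^∞ φ_p(σ|u|^{p/(p-1)}) dλ_θ : u ∈ X, ‖u‖ ≤ 1 }`. -/
noncomputable def TMC (p α θ σ : ℝ) : ℝ≥0∞ :=
  ⨆ (u : ℝ → ℝ) (u' : ℝ → ℝ) (_ : MemX p α θ u u') (_ : Xnorm p α θ u u' ≤ 1),
    TMfunc p θ σ u

/-- `k₀ = min { j ∈ ℕ : j ≥ p - 1 }`. -/
noncomputable def k0 (p : ℝ) : ℕ := sInf {j : ℕ | p - 1 ≤ (j : ℝ)}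

/-- `TMC(σ,α,θ)` is attained by some `u ∈ X` with `‖u‖ ≤ 1`. -/
def TMCAttained (p α θ σ : ℝ) : Prop :=
  ∃ u u' : ℝ → ℝ, MemX p α θ u u' ∧ Xnorm p α θ u u' ≤ 1 ∧
    TMC p α θ σ = TMfunc p θ σ u

/-- `σ_* = inf { σ ∈ (0, μ_{α,θ}) : TMC(σ,α,θ) is attained }`. -/
noncomputable def sigmaStar (p α θ : ℝ) : ℝ :=
  sInf {σ : ℝ | σ ∈ Set.Ioo 0 (muC α θ) ∧ TMCAttained p α θ σ}

/-- The exponential minus its Taylor polynomial of degree less than `m`. -/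
noncomputable def expTail (m : ℕ) (t : ℝ) : ℝ :=
  Real.exp t - ∑ j ∈ Finset.range m, t ^ j / (Nat.factorial j : ℝ)

lemma expTail_hasSum (m : ℕ) (t : ℝ) :
    HasSum (fun j : ℕ => t ^ (j + m) / (Nat.factorial (j + m) : ℝ)) (expTail m t) := by
  have h : HasSum (fun j : ℕ => t ^ j / (Nat.factorial j : ℝ)) (Real.exp t) := by
    rw [Real.exp_eq_exp_ℝ]
    exact NormedSpace.expSeries_div_hasSum_exp t
  exact (hasSum_nat_add_iff' m).2 h

lemma expTail_eq_add (m : ℕ) (t : ℝ) :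
    expTail m t = t ^ m / (Nat.factorial m : ℝ) + expTail (m + 1) t := by
  unfold expTail
  rw [Finset.sum_range_succ]
  ring

lemma expTail_nonneg (m : ℕ) {t : ℝ} (ht : 0 ≤ t) : 0 ≤ expTail m t :=
  (expTail_hasSum m t).nonneg fun j => by positivity

lemma expTail_pos (m : ℕ) {t : ℝ} (ht : 0 < t) : 0 < expTail m t := by
  rw [expTail_eq_add]
  have := expTail_nonneg (m + 1) ht.le
  positivity

lemma expTail_le_exp (m : ℕ) {t : ℝ} (ht : 0 ≤ t) : expTail m t ≤ Real.exp t := by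
  unfold expTail
  have : 0 ≤ ∑ j ∈ Finset.range m, t ^ j / (Nat.factorial j : ℝ) :=
    Finset.sum_nonneg fun j _ => by positivity
  linarith

lemma expTail_le_pow_mul_exp (m : ℕ) {t : ℝ} (ht : 0 ≤ t) :
    expTail m t ≤ t ^ m * Real.exp t := by
  have h0 : expTail 0 t = Real.exp t := by simp [expTail]
  have h := (expTail_hasSum 0 t).mul_left (t ^ m)
  rw [h0] at h
  refine hasSum_le (fun j => ?_) (expTail_hasSum m t) h
  rw [pow_add, mul_comm (t ^ j), mul_div_assoc]
  simp only [add_zero]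
  gcongr
  omega

lemma pow_mul_expTail_le (m : ℕ) {c t : ℝ} (hc : 1 ≤ c) (ht : 0 ≤ t) :
    c ^ m * expTail m t ≤ expTail m (c * t) := by
  refine hasSum_le (fun j => ?_) ((expTail_hasSum m t).mul_left (c ^ m)) (expTail_hasSum m (c * t))
  rw [mul_pow, ← mul_div_assoc]
  gcongr
  · omega

lemma continuous_expTail (m : ℕ) : Continuous (expTail m) := by
  unfold expTail
  fun_prop

lemma phiP_eq_expTail {p : ℝ} {k : ℕ} (hk : (k : ℝ) = p - 1) (t : ℝ) :
    phiP p t = expTail k t := by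
  unfold phiP
  rw [← hk]
  have h : HasSum (fun j : ℕ => if (k : ℝ) ≤ (j : ℝ) then t ^ j / (Nat.factorial j : ℝ) else 0)
      (expTail k t + ∑ j ∈ Finset.range k,
        if (k : ℝ) ≤ (j : ℝ) then t ^ j / (Nat.factorial j : ℝ) else 0) := by
    refine (hasSum_nat_add_iff k).1 ?_
    simpa using expTail_hasSum k t
  rw [h.tsum_eq]
  rw [Finset.sum_eq_zero, add_zero]
  intro j hj
  have := Finset.mem_range.1 hj
  rw [if_neg]
  exact_mod_cast not_le.2 this

lemma omegaW_pos {θ : ℝ} (hθ : 0 ≤ θ) : 0 < omegaW θ := by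
  unfold omegaW
  have := Real.Gamma_pos_of_pos (show 0 < (θ + 1) / 2 by linarith)
  positivity

lemma wInt_mono {θ : ℝ} {f g : ℝ → ℝ} (h : ∀ r, 0 < r → f r ≤ g r) : wInt θ f ≤ wInt θ g := by
  unfold wInt
  refine mul_le_mul' le_rfl (setLIntegral_mono' measurableSet_Ioi fun r hr => ?_)
  gcongr
  exact h r hr

lemma wInt_congr {θ : ℝ} {f g : ℝ → ℝ} (h : ∀ r, 0 < r → f r = g r) : wInt θ f = wInt θ g :=
  le_antisymm (wInt_mono fun r hr => (h r hr).le) (wInt_mono fun r hr => (h r hr).ge)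

lemma wInt_const_mul {θ c : ℝ} (hc : 0 ≤ c) (f : ℝ → ℝ) :
    wInt θ (fun r => c * f r) = ENNReal.ofReal c * wInt θ f := by
  unfold wInt
  simp only [ENNReal.ofReal_mul hc, mul_assoc]
  rw [lintegral_const_mul' _ _ ENNReal.ofReal_ne_top]
  ring

lemma wInt_add {θ : ℝ} {f g : ℝ → ℝ} (hf : ∀ r, 0 < r → 0 ≤ f r) (hg : ∀ r, 0 < r → 0 ≤ g r)
    (hfm : AEMeasurable f (volume.restrict (Set.Ioi 0))) :
    wInt θ (fun r => f r + g r) = wInt θ f + wInt θ g := by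
  unfold wInt
  rw [← mul_add, ← lintegral_add_left']
  · congr 1
    refine setLIntegral_congr_fun measurableSet_Ioi fun r hr => ?_
    simp only
    rw [ENNReal.ofReal_add (hf r hr) (hg r hr), add_mul]
  · exact hfm.ennreal_ofReal.mul (by fun_prop)

lemma wInt_comp_mul {θ c : ℝ} (hc : 0 < c) (f : ℝ → ℝ) :
    wInt θ (fun r => f (c * r)) = ENNReal.ofReal (c ^ (-(θ + 1))) * wInt θ f := by
  unfold wInt
  have himg : (fun r => c * r) '' Set.Ioi (0 : ℝ) = Set.Ioi 0 := by
    simpa using Set.image_mul_left_Ioi hc 0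
  have h := lintegral_image_eq_lintegral_abs_deriv_mul (s := Set.Ioi (0 : ℝ))
    (f := fun r => c * r) (f' := fun _ => c) measurableSet_Ioi
    (fun x _ => by simpa using ((hasDerivAt_id x).const_mul c).hasDerivWithinAt)
    ((mul_right_injective₀ hc.ne').injOn)
    (fun r => ENNReal.ofReal (f r) * ENNReal.ofReal (r ^ θ))
  rw [himg] at h
  rw [h, ← lintegral_const_mul' _ _ (by simp), ← lintegral_const_mul' _ _ (by simp),
    ← lintegral_const_mul' _ _ (by simp)]
  refine setLIntegral_congr_fun measurableSet_Ioi fun r hr => ?_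
  have hr' : (0 : ℝ) < r := hr
  simp only
  have : ENNReal.ofReal (r ^ θ) = ENNReal.ofReal (c ^ (-(θ + 1))) * (ENNReal.ofReal |c| *
      ENNReal.ofReal ((c * r) ^ θ)) := by
    rw [← ENNReal.ofReal_mul (by positivity), ← ENNReal.ofReal_mul (by positivity)]
    congr 1
    rw [abs_of_pos hc, Real.mul_rpow hc.le hr'.le, ← mul_assoc, ← mul_assoc]
    nth_rw 2 [← Real.rpow_one c]
    rw [← Real.rpow_add hc, ← Real.rpow_add hc]
    simp
  rw [this]
  ring

lemma lintegral_eq_mul_wInt {θ : ℝ} (hθ : 0 ≤ θ) (f : ℝ → ℝ) :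
    ∫⁻ r in Set.Ioi (0 : ℝ), ENNReal.ofReal (f r) * ENNReal.ofReal (r ^ θ) =
      ENNReal.ofReal (omegaW θ)⁻¹ * wInt θ f := by
  unfold wInt
  rw [← mul_assoc, ← ENNReal.ofReal_mul (by have := omegaW_pos hθ; positivity),
    inv_mul_cancel₀ (omegaW_pos hθ).ne']
  simp

lemma wInt_eq_zero {θ : ℝ} (hθ : 0 ≤ θ) {f : ℝ → ℝ}
    (hfm : AEMeasurable f (volume.restrict (Set.Ioi 0))) (h : wInt θ f = 0) :
    ∀ᵐ r ∂(volume.restrict (Set.Ioi (0 : ℝ))), f r ≤ 0 := by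
  have h1 := lintegral_eq_mul_wInt hθ f
  have hm : AEMeasurable (fun r => ENNReal.ofReal (f r) * ENNReal.ofReal (r ^ θ))
    (volume.restrict (Set.Ioi 0)) := hfm.ennreal_ofReal.mul (by fun_prop)
  rw [h, mul_zero, lintegral_eq_zero_iff' hm] at h1
  filter_upwards [h1, ae_restrict_mem measurableSet_Ioi] with r hr hr0
  have : (0 : ℝ) < r ^ θ := Real.rpow_pos_of_pos hr0 _
  simpa [this.not_ge] using hr

lemma wInt_congr_ae {θ : ℝ} {f g : ℝ → ℝ}
    (h : f =ᵐ[volume.restrict (Set.Ioi (0 : ℝ))] g) : wInt θ f = wInt θ g := by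
  unfold wInt
  congr 1
  refine lintegral_congr_ae ?_
  filter_upwards [h] with r hr
  rw [hr]

/-- Membership in the closed unit ball of `X`, in terms of weighted integrals. -/
def Admissible (p α θ : ℝ) (u u' : ℝ → ℝ) : Prop :=
  MemX p α θ u u' ∧ wInt θ (fun r => |u r| ^ p) + wInt α (fun r => |u' r| ^ p) ≤ 1

lemma wNorm_rpow {p : ℝ} (hp : 0 < p) (θ : ℝ) (u : ℝ → ℝ) :
    wNorm θ p u ^ p = wInt θ fun r => |u r| ^ p := by
  unfold wNorm
  rw [← ENNReal.rpow_mul, one_div_mul_cancel hp.ne', ENNReal.rpow_one]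

lemma wNorm_lt_top_iff {p : ℝ} (hp : 0 < p) (θ : ℝ) (u : ℝ → ℝ) :
    wNorm θ p u < ⊤ ↔ wInt θ (fun r => |u r| ^ p) < ⊤ := by
  unfold wNorm
  rw [ENNReal.rpow_lt_top_iff_of_pos (by positivity)]

lemma Xnorm_le_one_iff {p : ℝ} (hp : 0 < p) (α θ : ℝ) (u u' : ℝ → ℝ) :
    Xnorm p α θ u u' ≤ 1 ↔
      wInt θ (fun r => |u r| ^ p) + wInt α (fun r => |u' r| ^ p) ≤ 1 := by
  unfold Xnorm
  rw [wNorm_rpow hp, wNorm_rpow hp]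
  conv_lhs => rw [← ENNReal.one_rpow (1 / p)]
  rw [ENNReal.rpow_le_rpow_iff (by positivity)]

lemma TMC_eq_iSup {p : ℝ} (hp : 0 < p) (α θ σ : ℝ) :
    TMC p α θ σ = ⨆ (u : ℝ → ℝ) (u' : ℝ → ℝ) (_ : Admissible p α θ u u'), TMfunc p θ σ u := by
  unfold TMC Admissible
  simp only [Xnorm_le_one_iff hp, iSup_and]

lemma Admissible.TMfunc_le {p : ℝ} (hp : 0 < p) {α θ σ : ℝ} {u u' : ℝ → ℝ}
    (h : Admissible p α θ u u') : TMfunc p θ σ u ≤ TMC p α θ σ := by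
  rw [TMC_eq_iSup hp]
  exact le_iSup_of_le u (le_iSup_of_le u' (le_iSup_of_le h le_rfl))

lemma TMC_le {p : ℝ} (hp : 0 < p) {α θ σ : ℝ} {C : ℝ≥0∞}
    (h : ∀ u u', Admissible p α θ u u' → TMfunc p θ σ u ≤ C) : TMC p α θ σ ≤ C := by
  rw [TMC_eq_iSup hp]
  exact iSup_le fun u => iSup_le fun u' => iSup_le fun hu => h u u' hu

lemma TMCAttained_iff {p : ℝ} (hp : 0 < p) (α θ σ : ℝ) :
    TMCAttained p α θ σ ↔ ∃ u u', Admissible p α θ u u' ∧ TMC p α θ σ = TMfunc p θ σ u := by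
  unfold TMCAttained Admissible
  simp only [Xnorm_le_one_iff hp, and_assoc]

section

variable {p α θ : ℝ} {u u' : ℝ → ℝ}

lemma MemX.continuousOn (h : MemX p α θ u u') : ContinuousOn u (Set.Ioi 0) := by
  intro x hx
  have hx0 : (0 : ℝ) < x := hx
  have hle : x / 2 ≤ 2 * x := by linarith
  have h_int := h.ftc_int (x / 2) (2 * x) (by linarith) hle
  have hc := intervalIntegral.continuousOn_primitive_interval
    (((intervalIntegrable_iff_integrableOn_Icc_of_le hle).1 h_int).mono_set
      (Set.uIcc_of_le hle).le)
  have hnhds : Set.uIcc (x / 2) (2 * x) ∈ nhds x := by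
    rw [Set.uIcc_of_le hle]
    exact Icc_mem_nhds (by linarith) (by linarith)
  have hca := (hc.continuousAt hnhds).const_add (u (x / 2))
  refine ContinuousAt.continuousWithinAt (hca.congr ?_)
  filter_upwards [Icc_mem_nhds (show x / 2 < x by linarith) (show x < 2 * x by linarith)]
    with y hy
  have := h.ftc (x / 2) y (by linarith) hy.1
  linarith

lemma MemX.aemeasurable (h : MemX p α θ u u') :
    AEMeasurable u (volume.restrict (Set.Ioi 0)) :=
  h.continuousOn.aemeasurable measurableSet_Ioi

lemma MemX.aemeasurable_deriv (h : MemX p α θ u u') :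
    AEMeasurable u' (volume.restrict (Set.Ioi 0)) := by
  have hU : Set.Ioi (0 : ℝ) ⊆ ⋃ n : ℕ, Set.Ioc (1 / ((n : ℝ) + 1)) ((n : ℝ) + 1) := by
    intro x hx
    have hx0 : (0 : ℝ) < x := hx
    obtain ⟨n, hn⟩ := exists_nat_gt (max x x⁻¹)
    have h1 : x < n := (le_max_left _ _).trans_lt hn
    have h2 : x⁻¹ < n := (le_max_right _ _).trans_lt hn
    refine Set.mem_iUnion.2 ⟨n, ?_, by linarith⟩
    rw [one_div]
    exact inv_lt_of_inv_lt₀ hx0 (by linarith)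
  refine AEMeasurable.mono_set hU ?_
  rw [aemeasurable_iUnion_iff]
  intro n
  have hle : 1 / ((n : ℝ) + 1) ≤ (n : ℝ) + 1 := by
    rw [div_le_iff₀ (by positivity)]
    nlinarith [Nat.cast_nonneg (α := ℝ) n]
  have := h.ftc_int _ _ (by positivity) hle
  exact ((intervalIntegrable_iff_integrableOn_Ioc_of_le hle).1
    this).aestronglyMeasurable.aemeasurable

lemma MemX.abs_sub_le_lintegral (h : MemX p α θ u u') {s t : ℝ} (hs : 0 < s) (hst : s ≤ t) :
    ENNReal.ofReal |u t - u s| ≤ ∫⁻ r in Set.Ioc s t, ENNReal.ofReal |u' r| := by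
  rw [h.ftc s t hs hst, intervalIntegral.integral_of_le hst, ← Real.enorm_eq_ofReal_abs]
  simp only [← Real.enorm_eq_ofReal_abs]
  exact enorm_integral_le_lintegral_enorm _

lemma lintegral_abs_le_weighted (hp : 2 ≤ p) (hα : α = p - 1)
    (hm : AEMeasurable u' (volume.restrict (Set.Ioi 0))) {S : Set ℝ} (hS : MeasurableSet S)
    (hS0 : S ⊆ Set.Ioi 0) :
    ∫⁻ r in S, ENNReal.ofReal |u' r| ≤
      (∫⁻ r in Set.Ioi (0 : ℝ), ENNReal.ofReal (|u' r| ^ p) * ENNReal.ofReal (r ^ α)) ^ (1 / p) *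
      (∫⁻ r in S, ENNReal.ofReal r⁻¹) ^ ((p - 1) / p) := by
  have hp0 : 0 < p := by linarith
  have hpq : p.HolderConjugate (p / (p - 1)) := Real.HolderConjugate.conjExponent (by linarith)
  have hmS : AEMeasurable u' (volume.restrict S) := hm.mono_set hS0
  have key := ENNReal.lintegral_mul_le_Lp_mul_Lq (volume.restrict S) hpq
    (f := fun r => ENNReal.ofReal (|u' r| * r ^ ((p - 1) / p)))
    (g := fun r => ENNReal.ofReal (r ^ (-((p - 1) / p))))
    ((hmS.norm.mul (by fun_prop)).ennreal_ofReal) (by fun_prop)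
  have e1 : ∫⁻ r in S, ((fun r => ENNReal.ofReal (|u' r| * r ^ ((p - 1) / p))) *
      (fun r => ENNReal.ofReal (r ^ (-((p - 1) / p))))) r = ∫⁻ r in S, ENNReal.ofReal |u' r| := by
    refine setLIntegral_congr_fun hS fun r hr => ?_
    have hr0 : 0 < r := hS0 hr
    simp only [Pi.mul_apply]
    rw [← ENNReal.ofReal_mul (by positivity), mul_assoc, ← Real.rpow_add hr0]
    simp
  have e2 : ∫⁻ r in S, ENNReal.ofReal (|u' r| * r ^ ((p - 1) / p)) ^ p ≤
      ∫⁻ r in Set.Ioi (0 : ℝ), ENNReal.ofReal (|u' r| ^ p) * ENNReal.ofReal (r ^ α) := by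
    refine le_trans (le_of_eq ?_) (lintegral_mono_set hS0)
    refine setLIntegral_congr_fun hS fun r hr => ?_
    have hr0 : 0 < r := hS0 hr
    rw [ENNReal.ofReal_rpow_of_nonneg (by positivity) hp0.le, Real.mul_rpow (by positivity)
      (by positivity), ENNReal.ofReal_mul (by positivity), ← Real.rpow_mul hr0.le,
      div_mul_cancel₀ _ hp0.ne', hα]
  have e3 : ∫⁻ r in S, ENNReal.ofReal (r ^ (-((p - 1) / p))) ^ (p / (p - 1)) =
      ∫⁻ r in S, ENNReal.ofReal r⁻¹ := by
    refine setLIntegral_congr_fun hS fun r hr => ?_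
    have hr0 : 0 < r := hS0 hr
    have : p - 1 ≠ 0 := by linarith
    rw [ENNReal.ofReal_rpow_of_nonneg (by positivity) (by
      have : 0 < p - 1 := by linarith
      positivity), ← Real.rpow_mul hr0.le]
    rw [show -((p - 1) / p) * (p / (p - 1)) = -1 by field_simp, Real.rpow_neg_one]
  rw [e1, e3, one_div_div] at key
  exact key.trans (by gcongr)

lemma Admissible.wInt_le_one (h : Admissible p α θ u u') : wInt θ (fun r => |u r| ^ p) ≤ 1 :=
  le_self_add.trans h.2

lemma Admissible.wInt_deriv_le_one (h : Admissible p α θ u u') :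
    wInt α (fun r => |u' r| ^ p) ≤ 1 :=
  le_add_self.trans h.2

/-- The constant in the logarithmic modulus of continuity of the unit ball of `X`. -/
noncomputable def logConst (p α : ℝ) : ℝ := (omegaW α)⁻¹ ^ (1 / p)

lemma logConst_pos (hp : 2 ≤ p) (hα : α = p - 1) : 0 < logConst p α := by
  have := omegaW_pos (show 0 ≤ α by linarith)
  unfold logConst
  positivity

lemma Admissible.lintegral_deriv_le (hp : 2 ≤ p) (hα : α = p - 1) (h : Admissible p α θ u u')
    {S : Set ℝ} (hS : MeasurableSet S) (hS0 : S ⊆ Set.Ioi 0) :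
    ∫⁻ r in S, ENNReal.ofReal |u' r| ≤
      ENNReal.ofReal (logConst p α) * (∫⁻ r in S, ENNReal.ofReal r⁻¹) ^ ((p - 1) / p) := by
  refine (lintegral_abs_le_weighted hp hα h.1.aemeasurable_deriv hS hS0).trans ?_
  have hω := omegaW_pos (show 0 ≤ α by linarith)
  gcongr
  unfold logConst
  rw [← ENNReal.ofReal_rpow_of_nonneg (by positivity) (by positivity)]
  have hh := lintegral_eq_mul_wInt (show 0 ≤ α by linarith) (fun r => |u' r| ^ p)
  rw [hh]
  gcongr
  exact (mul_le_mul' le_rfl h.wInt_deriv_le_one).trans (by simp)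

lemma lintegral_inv_Ioc {s t : ℝ} (hs : 0 < s) (hst : s ≤ t) :
    ∫⁻ r in Set.Ioc s t, ENNReal.ofReal r⁻¹ = ENNReal.ofReal (Real.log (t / s)) := by
  rw [← integral_inv_of_pos hs (hs.trans_le hst), intervalIntegral.integral_of_le hst,
    ofReal_integral_eq_lintegral_ofReal]
  · have : IntervalIntegrable (fun x : ℝ => x⁻¹) volume s t := by
      refine intervalIntegral.intervalIntegrable_inv (fun x hx => ?_) continuousOn_id
      rw [Set.uIcc_of_le hst] at hx
      exact (hs.trans_le hx.1).ne'
    exact (intervalIntegrable_iff_integrableOn_Ioc_of_le hst).1 this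
  · filter_upwards [ae_restrict_mem measurableSet_Ioc] with x hx
    exact inv_nonneg.2 (hs.trans hx.1).le

lemma Admissible.abs_sub_le (hp : 2 ≤ p) (hα : α = p - 1) (h : Admissible p α θ u u')
    {s t : ℝ} (hs : 0 < s) (hst : s ≤ t) :
    |u t - u s| ≤ logConst p α * Real.log (t / s) ^ ((p - 1) / p) := by
  have h1 := (h.1.abs_sub_le_lintegral hs hst).trans
    (h.lintegral_deriv_le hp hα measurableSet_Ioc fun x hx => hs.trans hx.1)
  have hl : 0 ≤ Real.log (t / s) := Real.log_nonneg ((one_le_div hs).2 hst)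
  have := logConst_pos hp hα
  have hq : 0 ≤ (p - 1) / p := div_nonneg (by linarith) (by linarith)
  rw [lintegral_inv_Ioc hs hst, ENNReal.ofReal_rpow_of_nonneg hl hq,
    ← ENNReal.ofReal_mul this.le] at h1
  exact (ENNReal.ofReal_le_ofReal_iff (by positivity)).1 h1

end

section

variable {p α θ : ℝ} {u u' : ℝ → ℝ}

lemma exists_forall_admissible_abs_le (hp : 2 ≤ p) (hα : α = p - 1) (hθ : 0 ≤ θ) {ε : ℝ}
    (hε : 0 < ε) :
    ∃ R : ℝ, 1 ≤ R ∧ ∀ u u', Admissible p α θ u u' → ∀ r, R ≤ r → |u r| ≤ ε := by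
  have hK := logConst_pos hp hα
  have hω := omegaW_pos hθ
  have hq : 0 < (p - 1) / p := div_pos (by linarith) (by linarith)
  obtain ⟨δ, hδ, hδε⟩ : ∃ δ : ℝ, 0 < δ ∧
      logConst p α * Real.log (1 + δ) ^ ((p - 1) / p) < ε / 2 := by
    have hc : ContinuousAt (fun δ : ℝ => logConst p α * Real.log (1 + δ) ^ ((p - 1) / p)) 0 := by
      refine ContinuousAt.mul continuousAt_const (ContinuousAt.rpow_const ?_ (Or.inr hq.le))
      exact ContinuousAt.log (by fun_prop) (by norm_num)
    have h0 : logConst p α * Real.log (1 + 0) ^ ((p - 1) / p) < ε / 2 := by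
      simp [Real.zero_rpow hq.ne', hε]
    have hev := (hc.eventually (gt_mem_nhds h0)).filter_mono (nhdsWithin_le_nhds (s := Set.Ioi 0))
    obtain ⟨δ, h1, h2⟩ := (hev.and self_mem_nhdsWithin).exists
    exact ⟨δ, h2, h1⟩
  have hcpos : 0 < omegaW θ * ((ε / 2) ^ p * δ) := by positivity
  refine ⟨max 1 (1 / (omegaW θ * ((ε / 2) ^ p * δ)) + 1), le_max_left _ _, fun u u' h r hr => ?_⟩
  by_contra! hur
  have hr1 : 1 ≤ r := (le_max_left _ _).trans hr
  have hr2 : 1 / (omegaW θ * ((ε / 2) ^ p * δ)) < r := by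
    have := (le_max_right _ _).trans hr
    linarith
  have hr0 : 0 < r := by linarith
  have hlow : ∀ s ∈ Set.Ioc r (r + δ * r), ε / 2 ≤ |u s| := by
    intro s hs
    have h1 := h.abs_sub_le hp hα hr0 hs.1.le
    have h2 : Real.log (s / r) ≤ Real.log (1 + δ) := by
      have : 0 < s := hr0.trans hs.1
      refine Real.log_le_log (by positivity) ?_
      rw [div_le_iff₀ hr0]
      linarith [hs.2]
    have h3 : 0 ≤ Real.log (s / r) := Real.log_nonneg ((one_le_div hr0).2 hs.1.le)
    have h4 : logConst p α * Real.log (s / r) ^ ((p - 1) / p) ≤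
        logConst p α * Real.log (1 + δ) ^ ((p - 1) / p) := by gcongr
    have h5 : |u r| - |u s| ≤ |u s - u r| := by
      rw [abs_sub_comm]
      exact abs_sub_abs_le_abs_sub _ _
    linarith
  have hle : ENNReal.ofReal ((ε / 2) ^ p * (δ * r)) ≤
      ∫⁻ s in Set.Ioi (0 : ℝ), ENNReal.ofReal (|u s| ^ p) * ENNReal.ofReal (s ^ θ) := by
    calc ENNReal.ofReal ((ε / 2) ^ p * (δ * r))
        = ∫⁻ _ in Set.Ioc r (r + δ * r), ENNReal.ofReal ((ε / 2) ^ p) := by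
          rw [setLIntegral_const, Real.volume_Ioc, ENNReal.ofReal_mul (by positivity)]
          congr 2
          ring
      _ ≤ ∫⁻ s in Set.Ioc r (r + δ * r), ENNReal.ofReal (|u s| ^ p) * ENNReal.ofReal (s ^ θ) := by
          refine setLIntegral_mono' measurableSet_Ioc fun s hs => ?_
          rw [← ENNReal.ofReal_mul (by positivity)]
          have h1 := hlow s hs
          have h2 : 1 ≤ s ^ θ := Real.one_le_rpow (by linarith [hs.1]) hθ
          gcongr
          calc (ε / 2) ^ p ≤ |u s| ^ p := by gcongr
            _ ≤ |u s| ^ p * s ^ θ := le_mul_of_one_le_right (by positivity) h2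
      _ ≤ _ := lintegral_mono_set fun s hs => hr0.trans hs.1
  have h1 : ENNReal.ofReal (omegaW θ * ((ε / 2) ^ p * (δ * r))) ≤ 1 := by
    rw [ENNReal.ofReal_mul hω.le]
    exact (mul_le_mul' le_rfl hle).trans h.wInt_le_one
  rw [ENNReal.ofReal_le_one] at h1
  rw [div_lt_iff₀ hcpos] at hr2
  nlinarith

lemma exists_forall_admissible_abs_le_at (hp : 2 ≤ p) (hα : α = p - 1) (hθ : 0 ≤ θ) {r : ℝ}
    (hr : 0 < r) : ∃ M : ℝ, 0 < M ∧ ∀ u u', Admissible p α θ u u' → |u r| ≤ M := by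
  obtain ⟨R, hR1, hR⟩ := exists_forall_admissible_abs_le hp hα hθ one_pos
  have hK := logConst_pos hp hα
  have hl : 0 ≤ Real.log (max R r / r) := Real.log_nonneg ((one_le_div hr).2 (le_max_right _ _))
  refine ⟨1 + logConst p α * Real.log (max R r / r) ^ ((p - 1) / p), by positivity,
    fun u u' h => ?_⟩
  have h1 := h.abs_sub_le hp hα hr (le_max_right R r)
  have h2 := hR u u' h (max R r) (le_max_left _ _)
  have h3 := abs_sub_abs_le_abs_sub (u r) (u (max R r))
  rw [abs_sub_comm] at h3
  linarith

lemma add_rpow_le_of_le {q δ M a b : ℝ} (hq : 0 ≤ q) (hδ : 0 < δ) (ha : 0 ≤ a) (haM : a ≤ M)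
    (hb : 0 ≤ b) : (a + b) ^ q ≤ (1 + δ) ^ q * b ^ q + (M * (1 + 1 / δ)) ^ q := by
  have hM : 0 ≤ M := ha.trans haM
  have h1 : 0 ≤ (1 + δ) ^ q * b ^ q := by positivity
  have h2 : 0 ≤ (M * (1 + 1 / δ)) ^ q := by positivity
  rcases le_total a (δ * b) with h | h
  · rw [← Real.mul_rpow (by positivity) hb] at h1 ⊢
    have : (a + b) ^ q ≤ ((1 + δ) * b) ^ q := by
      gcongr
      linarith
    linarith
  · have : (a + b) ^ q ≤ (M * (1 + 1 / δ)) ^ q := by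
      have hb' : b ≤ a / δ := by
        rw [le_div_iff₀ hδ]
        linarith
      gcongr
      calc a + b ≤ a + a / δ := by linarith
        _ = a * (1 + 1 / δ) := by ring
        _ ≤ M * (1 + 1 / δ) := by gcongr
    linarith

lemma exists_exp_dominating (hp : 2 ≤ p) (hα : α = p - 1) (hθ : 0 ≤ θ) {σ : ℝ} (hσ : 0 ≤ σ)
    (hσμ : σ < muC α θ) {R : ℝ} (hR : 0 < R) :
    ∃ g : ℝ → ℝ,
      ∫⁻ r in Set.Ioc 0 R, ENNReal.ofReal (g r) * ENNReal.ofReal (r ^ θ) < ⊤ ∧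
      ∀ u u', Admissible p α θ u u' → ∀ r ∈ Set.Ioc 0 R,
        Real.exp (σ * |u r| ^ (p / (p - 1))) ≤ g r := by
  have hp1 : 0 < p - 1 := by linarith
  have hq : 0 < p / (p - 1) := by positivity
  have hα0 : 0 < α := by linarith
  have hω := omegaW_pos hα0.le
  have hK := logConst_pos hp hα
  have hKq : logConst p α ^ (p / (p - 1)) = ((omegaW α) ^ (1 / α))⁻¹ := by
    unfold logConst
    rw [← Real.rpow_mul (by positivity), Real.inv_rpow hω.le, hα]
    congr 2
    field_simp
  have hlt : σ * logConst p α ^ (p / (p - 1)) < θ + 1 := by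
    rw [hKq, ← div_eq_mul_inv, div_lt_iff₀ (by positivity)]
    exact hσμ
  obtain ⟨δ, hδ, hδσ⟩ : ∃ δ : ℝ, 0 < δ ∧
      σ * ((1 + δ) ^ (p / (p - 1)) * logConst p α ^ (p / (p - 1))) < θ + 1 := by
    have hc : ContinuousAt (fun δ : ℝ =>
        σ * ((1 + δ) ^ (p / (p - 1)) * logConst p α ^ (p / (p - 1)))) 0 := by
      refine ContinuousAt.mul continuousAt_const (ContinuousAt.mul ?_ continuousAt_const)
      exact ContinuousAt.rpow_const (by fun_prop) (Or.inr hq.le)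
    have h0 : σ * ((1 + 0) ^ (p / (p - 1)) * logConst p α ^ (p / (p - 1))) < θ + 1 := by
      simpa using hlt
    have hev := (hc.eventually (gt_mem_nhds h0)).filter_mono (nhdsWithin_le_nhds (s := Set.Ioi 0))
    obtain ⟨δ, h1, h2⟩ := (hev.and self_mem_nhdsWithin).exists
    exact ⟨δ, h2, h1⟩
  set γ := σ * ((1 + δ) ^ (p / (p - 1)) * logConst p α ^ (p / (p - 1))) with hγ
  obtain ⟨M, hM, hMu⟩ := exists_forall_admissible_abs_le_at hp hα hθ hR
  set C := σ * (M * (1 + 1 / δ)) ^ (p / (p - 1)) with hC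
  refine ⟨fun r => Real.exp C * R ^ γ * r ^ (-γ), ?_, fun u u' h r hr => ?_⟩
  · have h_int : IntegrableOn (fun r : ℝ => r ^ (θ - γ)) (Set.Ioc 0 R) := by
      rw [← intervalIntegrable_iff_integrableOn_Ioc_of_le hR.le]
      exact intervalIntegral.intervalIntegrable_rpow' (by linarith)
    have hfin := (h_int.const_mul (Real.exp C * R ^ γ)).lintegral_lt_top
    refine lt_of_le_of_lt (le_of_eq ?_) hfin
    refine setLIntegral_congr_fun measurableSet_Ioc fun r hr => ?_
    have hr0 : 0 < r := hr.1
    simp only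
    rw [← ENNReal.ofReal_mul (by positivity), mul_assoc _ (r ^ (-γ)), ← Real.rpow_add hr0]
    congr 3
    ring
  · have hr0 : 0 < r := hr.1
    have hl : 0 ≤ Real.log (R / r) := Real.log_nonneg ((one_le_div hr0).2 hr.2)
    have h1 := h.abs_sub_le hp hα hr0 hr.2
    have h2 := hMu u u' h
    have h3 := abs_sub_abs_le_abs_sub (u r) (u R)
    rw [abs_sub_comm] at h3
    have h4 : |u r| ≤ |u R| + logConst p α * Real.log (R / r) ^ ((p - 1) / p) := by linarith
    have h5 : |u r| ^ (p / (p - 1)) ≤ (1 + δ) ^ (p / (p - 1)) *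
        (logConst p α ^ (p / (p - 1)) * Real.log (R / r)) + (M * (1 + 1 / δ)) ^ (p / (p - 1)) := by
      calc |u r| ^ (p / (p - 1))
          ≤ (|u R| + logConst p α * Real.log (R / r) ^ ((p - 1) / p)) ^ (p / (p - 1)) := by gcongr
        _ ≤ _ := add_rpow_le_of_le hq.le hδ (abs_nonneg _) h2 (by positivity)
        _ = _ := by
          rw [Real.mul_rpow hK.le (by positivity), ← Real.rpow_mul hl]
          rw [show (p - 1) / p * (p / (p - 1)) = 1 by field_simp, Real.rpow_one]
    calc Real.exp (σ * |u r| ^ (p / (p - 1)))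
        ≤ Real.exp (γ * Real.log (R / r) + C) := by
          refine Real.exp_le_exp.2 ?_
          refine (mul_le_mul_of_nonneg_left h5 hσ).trans_eq ?_
          rw [hγ, hC]
          ring
      _ = Real.exp C * R ^ γ * r ^ (-γ) := by
          rw [Real.exp_add, mul_comm γ, Real.exp_mul, Real.exp_log (by positivity),
            Real.div_rpow hR.le hr0.le, Real.rpow_neg hr0.le]
          ring

end

/-- The part of the Trudinger–Moser functional coming from the powers of order at least `k + 1`. -/
noncomputable def TMhigh (p θ : ℝ) (k : ℕ) (σ : ℝ) (u : ℝ → ℝ) : ℝ≥0∞ :=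
  wInt θ fun r => expTail (k + 1) (σ * |u r| ^ (p / (p - 1)))

section

variable {p α θ : ℝ} {k : ℕ} {u u' : ℝ → ℝ}

lemma mul_rpow_pow_eq (hp : 2 ≤ p) (hk : (k : ℝ) = p - 1) {σ x : ℝ} (hσ : 0 ≤ σ) (hx : 0 ≤ x) :
    (σ * x ^ (p / (p - 1))) ^ k = σ ^ (p - 1) * x ^ p := by
  have : p - 1 ≠ 0 := by linarith
  rw [← Real.rpow_natCast, hk, Real.mul_rpow hσ (by positivity), ← Real.rpow_mul hx,
    div_mul_cancel₀ _ this]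

lemma aemeasurable_abs_rpow {μ : Measure ℝ} (hu : AEMeasurable u μ) (q : ℝ) :
    AEMeasurable (fun r => |u r| ^ q) μ := by
  have h1 : AEMeasurable (fun r => |u r|) μ := hu.norm
  exact h1.pow_const q

lemma aemeasurable_expTail {μ : Measure ℝ} (hu : AEMeasurable u μ) (m : ℕ) (σ q : ℝ) :
    AEMeasurable (fun r => expTail m (σ * |u r| ^ q)) μ :=
  (continuous_expTail m).measurable.comp_aemeasurable
    ((aemeasurable_abs_rpow hu q).const_mul σ)

lemma TMfunc_eq_add (hp : 2 ≤ p) (hk : (k : ℝ) = p - 1) {σ : ℝ} (hσ : 0 ≤ σ)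
    (hu : AEMeasurable u (volume.restrict (Set.Ioi 0))) :
    TMfunc p θ σ u = ENNReal.ofReal (σ ^ (p - 1) / (Nat.factorial k : ℝ)) *
      wInt θ (fun r => |u r| ^ p) + TMhigh p θ k σ u := by
  unfold TMfunc TMhigh
  rw [← wInt_const_mul (by positivity), ← wInt_add]
  · refine wInt_congr fun r _ => ?_
    rw [phiP_eq_expTail hk, expTail_eq_add, mul_rpow_pow_eq hp hk hσ (abs_nonneg _)]
    ring
  · intro r _
    positivity
  · intro r _
    exact expTail_nonneg _ (by positivity)
  · exact (aemeasurable_abs_rpow hu p).const_mul _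

lemma exists_forall_TMhigh_le (hp : 2 ≤ p) (hα : α = p - 1) (hθ : 0 ≤ θ) (hk : (k : ℝ) = p - 1)
    {σ ε : ℝ} (hσ : 0 ≤ σ) (hε : 0 < ε) :
    ∃ R : ℝ, 0 < R ∧ ∀ u u', Admissible p α θ u u' → TMhigh p θ k σ u ≤
      ENNReal.ofReal (omegaW θ) * (∫⁻ r in Set.Ioc 0 R,
        ENNReal.ofReal (expTail (k + 1) (σ * |u r| ^ (p / (p - 1)))) * ENNReal.ofReal (r ^ θ)) +
      ENNReal.ofReal ε := by
  have hp1 : 0 < p - 1 := by linarith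
  have hq : 0 < p / (p - 1) := by positivity
  obtain ⟨η, hη, hηε⟩ : ∃ η : ℝ, 0 < η ∧ σ ^ (p - 1) * ((σ * η ^ (p / (p - 1))) *
      Real.exp (σ * η ^ (p / (p - 1)))) < ε := by
    have hc : ContinuousAt (fun η : ℝ => σ ^ (p - 1) * ((σ * η ^ (p / (p - 1))) *
      Real.exp (σ * η ^ (p / (p - 1))))) 0 := by
      have h1 : ContinuousAt (fun η : ℝ => η ^ (p / (p - 1))) 0 :=
        Real.continuousAt_rpow_const _ _ (Or.inr hq.le)
      fun_prop
    have h0 : σ ^ (p - 1) * ((σ * (0 : ℝ) ^ (p / (p - 1))) *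
      Real.exp (σ * (0 : ℝ) ^ (p / (p - 1)))) < ε := by
      simp [Real.zero_rpow hq.ne', hε]
    have hev := (hc.eventually (gt_mem_nhds h0)).filter_mono (nhdsWithin_le_nhds (s := Set.Ioi 0))
    obtain ⟨η, h1, h2⟩ := (hev.and self_mem_nhdsWithin).exists
    exact ⟨η, h2, h1⟩
  obtain ⟨R, hR1, hR⟩ := exists_forall_admissible_abs_le hp hα hθ hη
  have hR0 : 0 < R := by linarith
  refine ⟨R, hR0, fun u u' h => ?_⟩
  set τ := σ * η ^ (p / (p - 1)) with hτ
  have hτ0 : 0 ≤ τ := by positivity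
  have htail : ∫⁻ r in Set.Ioi R, ENNReal.ofReal (expTail (k + 1) (σ * |u r| ^ (p / (p - 1)))) *
      ENNReal.ofReal (r ^ θ) ≤ ENNReal.ofReal (σ ^ (p - 1) * (τ * Real.exp τ)) *
        ∫⁻ r in Set.Ioi (0 : ℝ), ENNReal.ofReal (|u r| ^ p) * ENNReal.ofReal (r ^ θ) := by
    rw [← lintegral_const_mul' _ _ ENNReal.ofReal_ne_top]
    refine le_trans ?_ (lintegral_mono_set (Set.Ioi_subset_Ioi hR0.le))
    refine setLIntegral_mono' measurableSet_Ioi fun r hr => ?_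
    rw [← mul_assoc, ← ENNReal.ofReal_mul (p := σ ^ (p - 1) * (τ * Real.exp τ)) (by positivity)]
    refine mul_le_mul' (ENNReal.ofReal_le_ofReal ?_) le_rfl
    have hur : |u r| ≤ η := hR u u' h r (le_of_lt hr)
    have ht0 : 0 ≤ σ * |u r| ^ (p / (p - 1)) := by positivity
    have htτ : σ * |u r| ^ (p / (p - 1)) ≤ τ := by
      rw [hτ]
      gcongr
    refine (expTail_le_pow_mul_exp _ ht0).trans ?_
    rw [pow_succ, mul_rpow_pow_eq hp hk hσ (abs_nonneg _)]
    calc σ ^ (p - 1) * |u r| ^ p * (σ * |u r| ^ (p / (p - 1))) *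
          Real.exp (σ * |u r| ^ (p / (p - 1)))
        ≤ σ ^ (p - 1) * |u r| ^ p * τ * Real.exp τ := by gcongr
      _ = _ := by ring
  unfold TMhigh wInt
  rw [← Set.Ioc_union_Ioi_eq_Ioi hR0.le, lintegral_union measurableSet_Ioi
    (Set.Ioc_disjoint_Ioi le_rfl), mul_add]
  gcongr
  calc ENNReal.ofReal (omegaW θ) * ∫⁻ r in Set.Ioi R,
        ENNReal.ofReal (expTail (k + 1) (σ * |u r| ^ (p / (p - 1)))) * ENNReal.ofReal (r ^ θ)
      ≤ ENNReal.ofReal (omegaW θ) * (ENNReal.ofReal (σ ^ (p - 1) * (τ * Real.exp τ)) *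
        ∫⁻ r in Set.Ioi (0 : ℝ), ENNReal.ofReal (|u r| ^ p) * ENNReal.ofReal (r ^ θ)) := by gcongr
    _ = ENNReal.ofReal (σ ^ (p - 1) * (τ * Real.exp τ)) * wInt θ fun r => |u r| ^ p := by
        unfold wInt
        ring
    _ ≤ ENNReal.ofReal (σ ^ (p - 1) * (τ * Real.exp τ)) * 1 := by
        gcongr
        exact h.wInt_le_one
    _ ≤ ENNReal.ofReal ε := by
        rw [mul_one]
        gcongr

lemma TMC_lt_top (hp : 2 ≤ p) (hα : α = p - 1) (hθ : 0 ≤ θ) (hk : (k : ℝ) = p - 1)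
    {σ : ℝ} (hσ : 0 ≤ σ) (hσμ : σ < muC α θ) : TMC p α θ σ < ⊤ := by
  obtain ⟨R, hR0, hR⟩ := exists_forall_TMhigh_le (σ := σ) hp hα hθ hk hσ one_pos
  obtain ⟨g, hg, hgu⟩ := exists_exp_dominating hp hα hθ hσ hσμ hR0
  refine lt_of_le_of_lt (TMC_le (by linarith) (C := ENNReal.ofReal (σ ^ (p - 1) /
    (Nat.factorial k : ℝ)) * 1 + (ENNReal.ofReal (omegaW θ) *
      (∫⁻ r in Set.Ioc 0 R, ENNReal.ofReal (g r) * ENNReal.ofReal (r ^ θ)) + ENNReal.ofReal 1))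
    fun u u' h => ?_) ?_
  · rw [TMfunc_eq_add hp hk hσ h.1.aemeasurable]
    refine add_le_add (mul_le_mul' le_rfl h.wInt_le_one) ((hR u u' h).trans ?_)
    refine add_le_add (mul_le_mul' le_rfl ?_) le_rfl
    refine setLIntegral_mono' measurableSet_Ioc fun r hr => ?_
    gcongr
    exact (expTail_le_exp _ (by positivity)).trans (hgu u u' h r hr)
  · have := ENNReal.mul_lt_top (ENNReal.ofReal_lt_top (r := omegaW θ)) hg
    simp [this]

lemma le_add_TMhigh_of_tendsto (hp : 2 ≤ p) (hα : α = p - 1) (hθ : 0 ≤ θ) (hk : (k : ℝ) = p - 1)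
    {σ : ℝ} (hσ : 0 ≤ σ) (hσμ : σ < muC α θ) {v v' : ℕ → ℝ → ℝ}
    (hv : ∀ n, Admissible p α θ (v n) (v' n))
    (hlim : ∀ r, 0 < r → Tendsto (fun n => v n r) atTop (nhds (u r))) {a L : ℝ≥0∞}
    (ha : Tendsto (fun n => wInt θ fun r => |v n r| ^ p) atTop (nhds a))
    (hL : Tendsto (fun n => TMfunc p θ σ (v n)) atTop (nhds L)) :
    L ≤ ENNReal.ofReal (σ ^ (p - 1) / (Nat.factorial k : ℝ)) * a + TMhigh p θ k σ u := by
  have hp1 : 0 < p - 1 := by linarith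
  have hq : 0 < p / (p - 1) := by positivity
  refine ENNReal.le_of_forall_pos_le_add fun ε hε _ => ?_
  obtain ⟨R, hR0, hR⟩ := exists_forall_TMhigh_le (σ := σ) hp hα hθ hk hσ
    (show (0 : ℝ) < ε from hε)
  obtain ⟨g, hg, hgu⟩ := exists_exp_dominating hp hα hθ hσ hσμ hR0
  have hI : Tendsto (fun n => ∫⁻ r in Set.Ioc 0 R,
      ENNReal.ofReal (expTail (k + 1) (σ * |v n r| ^ (p / (p - 1)))) * ENNReal.ofReal (r ^ θ))
      atTop (nhds (∫⁻ r in Set.Ioc 0 R,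
      ENNReal.ofReal (expTail (k + 1) (σ * |u r| ^ (p / (p - 1)))) * ENNReal.ofReal (r ^ θ))) := by
    refine tendsto_lintegral_of_dominated_convergence'
      (fun r => ENNReal.ofReal (g r) * ENNReal.ofReal (r ^ θ)) (fun n => ?_) (fun n => ?_)
      hg.ne ?_
    · exact (aemeasurable_expTail ((hv n).1.aemeasurable.mono_set fun x hx => hx.1) _ _
        _).ennreal_ofReal.mul (by fun_prop)
    · filter_upwards [ae_restrict_mem measurableSet_Ioc] with r hr
      gcongr
      exact (expTail_le_exp _ (by positivity)).trans (hgu _ _ (hv n) r hr)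
    · filter_upwards [ae_restrict_mem measurableSet_Ioc] with r hr
      refine ENNReal.Tendsto.mul_const ?_ (Or.inr ENNReal.ofReal_ne_top)
      refine ENNReal.tendsto_ofReal (((continuous_expTail _).tendsto _).comp ?_)
      exact ((hlim r hr.1).abs.rpow_const (Or.inr hq.le)).const_mul σ
  have hω : ENNReal.ofReal (omegaW θ) ≠ ⊤ := ENNReal.ofReal_ne_top
  have hlim' := ((ENNReal.Tendsto.const_mul (a := ENNReal.ofReal (σ ^ (p - 1) /
    (Nat.factorial k : ℝ))) ha (Or.inr ENNReal.ofReal_ne_top)).add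
    ((ENNReal.Tendsto.const_mul hI (Or.inr hω)).add_const (ENNReal.ofReal ε)))
  refine (le_of_tendsto_of_tendsto' hL hlim' fun n => ?_).trans ?_
  · rw [TMfunc_eq_add hp hk hσ (hv n).1.aemeasurable]
    exact add_le_add le_rfl (hR _ _ (hv n))
  · rw [add_assoc, ENNReal.ofReal_coe_nnreal]
    refine add_le_add le_rfl (add_le_add ?_ le_rfl)
    exact mul_le_mul' le_rfl (lintegral_mono_set fun x hx => hx.1)

lemma TMhigh_eq_zero_iff (hp : 2 ≤ p) (hθ : 0 ≤ θ) {σ : ℝ} (hσ : 0 < σ)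
    (hu : AEMeasurable u (volume.restrict (Set.Ioi 0))) :
    TMhigh p θ k σ u = 0 ↔ wInt θ (fun r => |u r| ^ p) = 0 := by
  have hp1 : 0 < p - 1 := by linarith
  have hq : 0 < p / (p - 1) := by positivity
  have hp0 : 0 < p := by linarith
  have hw0 : wInt θ (fun _ => 0) = 0 := by simp [wInt]
  constructor
  · intro h
    have h1 := wInt_eq_zero hθ (aemeasurable_expTail hu _ _ _) h
    rw [← hw0]
    refine wInt_congr_ae ?_
    filter_upwards [h1] with r hr
    by_contra hne
    have hur : u r ≠ 0 := by
      rintro h0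
      exact hne (by simp [h0, Real.zero_rpow hp0.ne'])
    exact hr.not_gt (expTail_pos _ (by positivity))
  · intro h
    have h1 := wInt_eq_zero hθ (aemeasurable_abs_rpow hu p) h
    unfold TMhigh
    rw [← hw0]
    refine wInt_congr_ae ?_
    filter_upwards [h1] with r hr
    have hur : u r = 0 := by
      by_contra hne
      have : 0 < |u r| ^ p := by positivity
      linarith
    simp [hur, Real.zero_rpow hq.ne', expTail, Finset.sum_range_succ']

lemma mul_TMhigh_le {σ ρ : ℝ} (hσ : 0 ≤ σ) (hρ : 1 ≤ ρ) :
    ENNReal.ofReal (ρ ^ (k + 1)) * TMhigh p θ k σ u ≤ TMhigh p θ k (ρ * σ) u := by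
  unfold TMhigh
  rw [← wInt_const_mul (by positivity)]
  refine wInt_mono fun r _ => ?_
  rw [mul_assoc]
  exact pow_mul_expTail_le _ hρ (by positivity)

end

section

variable {p α θ : ℝ} {k : ℕ} {u u' : ℝ → ℝ}

lemma wInt_scale {s c : ℝ} (hc : 0 < c) (θ : ℝ) (f : ℝ → ℝ) :
    wInt θ (fun r => |s * f (c * r)| ^ p) =
      ENNReal.ofReal (|s| ^ p * c ^ (-(θ + 1))) * wInt θ (fun r => |f r| ^ p) := by
  simp only [abs_mul, Real.mul_rpow (abs_nonneg _) (abs_nonneg _)]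
  rw [wInt_const_mul (by positivity), wInt_comp_mul hc (fun r => |f r| ^ p), ← mul_assoc,
    ← ENNReal.ofReal_mul (by positivity)]

lemma wInt_deriv_scale (hα : α = p - 1) {s c : ℝ} (hc : 0 < c) (f : ℝ → ℝ) :
    wInt α (fun r => |s * c * f (c * r)| ^ p) =
      ENNReal.ofReal (|s| ^ p) * wInt α (fun r => |f r| ^ p) := by
  rw [wInt_scale hc, abs_mul, Real.mul_rpow (abs_nonneg _) (abs_nonneg _), abs_of_pos hc,
    mul_assoc, ← Real.rpow_add hc, hα]
  simp

lemma MemX.scale (hp : 0 < p) (hα : α = p - 1) (h : MemX p α θ u u') (s : ℝ) {c : ℝ}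
    (hc : 0 < c) : MemX p α θ (fun r => s * u (c * r)) (fun r => s * c * u' (c * r)) where
  ftc_int a b ha hab := by
    have h1 := (h.ftc_int (c * a) (c * b) (by positivity) (by gcongr)).comp_mul_left (c := c)
    rw [mul_div_cancel_left₀ _ hc.ne', mul_div_cancel_left₀ _ hc.ne'] at h1
    exact h1.const_mul (s * c)
  ftc a b ha hab := by
    have h1 := h.ftc (c * a) (c * b) (by positivity) (by gcongr)
    rw [intervalIntegral.integral_const_mul, mul_assoc,
      intervalIntegral.mul_integral_comp_mul_left, ← h1]
    ring
  lim_zero := by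
    simpa using (h.lim_zero.comp (tendsto_id.const_mul_atTop hc)).const_mul s
  fin_u := by
    rw [wNorm_lt_top_iff hp, wInt_scale hc]
    exact ENNReal.mul_lt_top ENNReal.ofReal_lt_top ((wNorm_lt_top_iff hp θ u).1 h.fin_u)
  fin_u' := by
    rw [wNorm_lt_top_iff hp, wInt_deriv_scale hα hc]
    exact ENNReal.mul_lt_top ENNReal.ofReal_lt_top ((wNorm_lt_top_iff hp α u').1 h.fin_u')

lemma wInt_exp_neg_lt_top (hp : 1 ≤ p) (hθ : 0 ≤ θ) :
    wInt θ (fun r => |Real.exp (-r)| ^ p) < ⊤ := by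
  have h1 := (Real.GammaIntegral_convergent (s := θ + 1) (by linarith)).lintegral_lt_top
  refine ENNReal.mul_lt_top ENNReal.ofReal_lt_top (lt_of_le_of_lt ?_ h1)
  refine setLIntegral_mono' measurableSet_Ioi fun r hr => ?_
  have hr0 : (0 : ℝ) < r := hr
  rw [← ENNReal.ofReal_mul (by positivity), add_sub_cancel_right]
  gcongr
  simp only [abs_of_pos (Real.exp_pos _)]
  exact Real.rpow_le_self_of_le_one (Real.exp_pos _).le (by simpa using hr0.le) hp

lemma memX_exp_neg (hp : 2 ≤ p) (hα : α = p - 1) (hθ : 0 ≤ θ) :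
    MemX p α θ (fun r => Real.exp (-r)) (fun r => -Real.exp (-r)) where
  ftc_int a b _ _ := by
    refine Continuous.intervalIntegrable ?_ _ _
    fun_prop
  ftc a b _ _ := by
    have hc : Continuous fun r : ℝ => -Real.exp (-r) := by fun_prop
    refine (intervalIntegral.integral_eq_sub_of_hasDerivAt (f := fun r => Real.exp (-r))
      (fun x _ => ?_) (hc.intervalIntegrable _ _)).symm
    simpa using (hasDerivAt_neg x).exp
  lim_zero := Real.tendsto_exp_neg_atTop_nhds_zero
  fin_u := by
    rw [wNorm_lt_top_iff (by linarith)]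
    exact wInt_exp_neg_lt_top (by linarith) hθ
  fin_u' := by
    rw [wNorm_lt_top_iff (by linarith)]
    simp only [abs_neg]
    exact wInt_exp_neg_lt_top (by linarith) (by linarith)

lemma exists_admissible_wInt_eq (hp : 2 ≤ p) (hα : α = p - 1) (hθ : 0 ≤ θ) {ε : ℝ} (hε : 0 < ε)
    (hε1 : ε < 1) :
    ∃ u u', Admissible p α θ u u' ∧ wInt θ (fun r => |u r| ^ p) = ENNReal.ofReal (1 - ε) := by
  have hp0 : 0 < p := by linarith
  have hX := memX_exp_neg hp hα hθ
  have hA := wInt_exp_neg_lt_top (p := p) (by linarith) hθ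
  have hB := wInt_exp_neg_lt_top (p := p) (θ := α) (by linarith) (by linarith)
  set A := wInt θ (fun r => |Real.exp (-r)| ^ p) with hAdef
  set B := wInt α (fun r => |Real.exp (-r)| ^ p) with hBdef
  have hA0 : A ≠ 0 := by
    intro h0
    have hae := wInt_eq_zero hθ (by fun_prop) h0
    have : (ae (volume.restrict (Set.Ioi (0 : ℝ)))).NeBot := ae_restrict_neBot.2 (by simp)
    obtain ⟨r, hr⟩ := hae.exists
    have : 0 < |Real.exp (-r)| ^ p := by positivity
    linarith
  have ha : 0 < A.toReal := ENNReal.toReal_pos hA0 hA.ne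
  set S := ε / (B.toReal + 1) with hS
  have hS0 : 0 < S := by positivity
  have hsS : |S ^ (1 / p)| ^ p = S := by
    rw [abs_of_pos (by positivity), ← Real.rpow_mul hS0.le, one_div_mul_cancel hp0.ne',
      Real.rpow_one]
  have h1ε : 0 < 1 - ε := by linarith
  set c := ((1 - ε) / (S * A.toReal)) ^ (-(θ + 1)⁻¹) with hc
  have hQ : 0 < (1 - ε) / (S * A.toReal) := by positivity
  have hc0 : 0 < c := by positivity
  have hcQ : c ^ (-(θ + 1)) = (1 - ε) / (S * A.toReal) := by
    rw [hc, ← Real.rpow_mul hQ.le, neg_mul_neg, inv_mul_cancel₀ (by positivity), Real.rpow_one]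
  have hwA : wInt θ (fun r => |S ^ (1 / p) * Real.exp (-(c * r))| ^ p) =
      ENNReal.ofReal (1 - ε) := by
    rw [wInt_scale hc0 θ (fun r => Real.exp (-r)), hsS, hcQ, ← hAdef,
      ← ENNReal.ofReal_toReal hA.ne, ← ENNReal.ofReal_mul (by positivity),
      ENNReal.toReal_ofReal ha.le]
    congr 1
    field_simp
  refine ⟨_, _, ⟨hX.scale hp0 hα (S ^ (1 / p)) hc0, ?_⟩, hwA⟩
  rw [hwA, wInt_deriv_scale hα hc0 (fun r => -Real.exp (-r)), hsS]
  simp only [abs_neg]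
  rw [← hBdef, ← ENNReal.ofReal_toReal hB.ne, ← ENNReal.ofReal_mul hS0.le,
    ← ENNReal.ofReal_add h1ε.le (by positivity), ENNReal.ofReal_le_one]
  have : S * B.toReal ≤ ε := by
    rw [hS, div_mul_eq_mul_div, div_le_iff₀ (by positivity)]
    nlinarith
  linarith

lemma ofReal_le_TMC (hp : 2 ≤ p) (hα : α = p - 1) (hθ : 0 ≤ θ) (hk : (k : ℝ) = p - 1)
    {σ : ℝ} (hσ : 0 ≤ σ) :
    ENNReal.ofReal (σ ^ (p - 1) / (Nat.factorial k : ℝ)) ≤ TMC p α θ σ := by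
  have hlim : Tendsto (fun n : ℕ => ENNReal.ofReal (σ ^ (p - 1) / (Nat.factorial k : ℝ)) *
      ENNReal.ofReal (1 - 1 / ((n : ℝ) + 1))) atTop
      (nhds (ENNReal.ofReal (σ ^ (p - 1) / (Nat.factorial k : ℝ)) * ENNReal.ofReal (1 - 0))) := by
    refine ENNReal.Tendsto.const_mul (ENNReal.tendsto_ofReal ?_) (Or.inr ENNReal.ofReal_ne_top)
    exact tendsto_one_div_add_atTop_nhds_zero_nat.const_sub 1
  simp only [sub_zero, ENNReal.ofReal_one, mul_one] at hlim
  refine le_of_tendsto hlim ?_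
  filter_upwards [eventually_gt_atTop 0] with n hn
  have hn' : (0 : ℝ) < n := by exact_mod_cast hn
  obtain ⟨u, u', hu, hA⟩ := exists_admissible_wInt_eq hp hα hθ
    (show (0 : ℝ) < 1 / ((n : ℝ) + 1) by positivity)
    (by rw [div_lt_one (by positivity)]; linarith)
  rw [← hA]
  refine le_trans ?_ (hu.TMfunc_le (by linarith))
  rw [TMfunc_eq_add hp hk hσ hu.1.aemeasurable]
  exact le_self_add

end

section

variable {p α θ : ℝ} {k : ℕ} {u u' : ℝ → ℝ}

lemma lintegral_rpow_le {μ : Measure ℝ} (hp : 1 < p) {f : ℝ → ℝ≥0∞} (hf : AEMeasurable f μ) :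
    (∫⁻ t, f t ∂μ) ^ p ≤ μ Set.univ ^ (p - 1) * ∫⁻ t, f t ^ p ∂μ := by
  have hp0 : 0 < p := by linarith
  have hpq : p.HolderConjugate (p / (p - 1)) := Real.HolderConjugate.conjExponent hp
  have key := ENNReal.lintegral_mul_le_Lp_mul_Lq μ hpq hf (g := fun _ => 1) aemeasurable_const
  simp only [Pi.mul_apply, mul_one, ENNReal.one_rpow, lintegral_const, one_mul] at key
  calc (∫⁻ t, f t ∂μ) ^ p
      ≤ ((∫⁻ t, f t ^ p ∂μ) ^ (1 / p) * μ Set.univ ^ (1 / (p / (p - 1)))) ^ p := by gcongr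
    _ = μ Set.univ ^ (p - 1) * ∫⁻ t, f t ^ p ∂μ := by
      rw [ENNReal.mul_rpow_of_nonneg _ _ hp0.le, ← ENNReal.rpow_mul, ← ENNReal.rpow_mul,
        one_div_mul_cancel hp0.ne', ENNReal.rpow_one, mul_comm]
      congr 2
      field_simp

lemma MemX.diffQuot_le (hp : 2 ≤ p) (hα : α = p - 1) (h : MemX p α θ u u') {r d : ℝ}
    (hr : 0 < r) (hd : 0 < d) :
    ENNReal.ofReal (|d⁻¹ * (u (r + d) - u r)| ^ p) * ENNReal.ofReal (r ^ α) ≤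
      ENNReal.ofReal d⁻¹ * ∫⁻ t in Set.Ioc r (r + d),
        ENNReal.ofReal (|u' t| ^ p) * ENNReal.ofReal (t ^ α) := by
  have hp0 : 0 < p := by linarith
  have hm : AEMeasurable u' (volume.restrict (Set.Ioc r (r + d))) :=
    h.aemeasurable_deriv.mono_set fun x hx => hr.trans hx.1
  have h1 := h.abs_sub_le_lintegral hr (show r ≤ r + d by linarith)
  have h2 := lintegral_rpow_le (p := p) (by linarith) hm.norm.ennreal_ofReal
  simp only [Real.norm_eq_abs, Measure.restrict_apply_univ, Real.volume_Ioc,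
    add_sub_cancel_left] at h2
  have h3 : ENNReal.ofReal (|u (r + d) - u r|) ^ p ≤ ENNReal.ofReal d ^ (p - 1) *
      ∫⁻ t in Set.Ioc r (r + d), ENNReal.ofReal |u' t| ^ p := le_trans (by gcongr) h2
  have h4 : (∫⁻ t in Set.Ioc r (r + d), ENNReal.ofReal |u' t| ^ p) * ENNReal.ofReal (r ^ α) ≤
      ∫⁻ t in Set.Ioc r (r + d), ENNReal.ofReal (|u' t| ^ p) * ENNReal.ofReal (t ^ α) := by
    rw [← lintegral_mul_const' _ _ ENNReal.ofReal_ne_top]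
    refine setLIntegral_mono' measurableSet_Ioc fun t ht => ?_
    rw [ENNReal.ofReal_rpow_of_nonneg (abs_nonneg _) hp0.le]
    gcongr
    · linarith
    · exact ht.1.le
  have h5 : ENNReal.ofReal (d⁻¹ ^ p) * ENNReal.ofReal d ^ (p - 1) = ENNReal.ofReal d⁻¹ := by
    rw [ENNReal.ofReal_rpow_of_pos hd, ← ENNReal.ofReal_mul (by positivity),
      ← Real.rpow_neg_one d, ← Real.rpow_mul hd.le, ← Real.rpow_add hd]
    congr 2
    ring
  rw [abs_mul, abs_of_pos (inv_pos.2 hd), Real.mul_rpow (by positivity) (abs_nonneg _),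
    ENNReal.ofReal_mul (by positivity), ← h5]
  calc _ ≤ ENNReal.ofReal (d⁻¹ ^ p) * (ENNReal.ofReal d ^ (p - 1) *
      ∫⁻ t in Set.Ioc r (r + d), ENNReal.ofReal |u' t| ^ p) * ENNReal.ofReal (r ^ α) := by
        rw [← ENNReal.ofReal_rpow_of_nonneg (abs_nonneg (u (r + d) - u r)) hp0.le]
        gcongr
    _ = ENNReal.ofReal (d⁻¹ ^ p) * ENNReal.ofReal d ^ (p - 1) *
      ((∫⁻ t in Set.Ioc r (r + d), ENNReal.ofReal |u' t| ^ p) * ENNReal.ofReal (r ^ α)) := by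
        ring
    _ ≤ _ := by gcongr

lemma lintegral_lintegral_Ioc_le {G : ℝ → ℝ≥0∞} (hG : AEMeasurable G (volume.restrict (Set.Ioi 0)))
    {d : ℝ} (hd : 0 < d) :
    ∫⁻ r in Set.Ioi (0 : ℝ), ENNReal.ofReal d⁻¹ * ∫⁻ t in Set.Ioc r (r + d), G t ≤
      ∫⁻ t in Set.Ioi (0 : ℝ), G t := by
  set μ := volume.restrict (Set.Ioi (0 : ℝ)) with hμ
  set T : Set (ℝ × ℝ) := {x | x.1 < x.2 ∧ x.2 ≤ x.1 + d} with hT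
  have hTm : MeasurableSet T :=
    (measurableSet_lt measurable_fst measurable_snd).inter
      (measurableSet_le measurable_snd (measurable_fst.add_const d))
  have e1 : ∀ r ∈ Set.Ioi (0 : ℝ), ∫⁻ t in Set.Ioc r (r + d), G t =
      ∫⁻ t, T.indicator (fun x => G x.2) (r, t) ∂μ := by
    intro r hr
    rw [← lintegral_indicator measurableSet_Ioc, hμ, ← lintegral_indicator measurableSet_Ioi]
    congr 1
    ext t
    by_cases ht : t ∈ Set.Ioc r (r + d)
    · have h0 : t ∈ Set.Ioi (0 : ℝ) := lt_trans hr ht.1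
      have h1 : (r, t) ∈ T := ht
      rw [Set.indicator_of_mem ht, Set.indicator_of_mem h0, Set.indicator_of_mem h1]
    · have h1 : (r, t) ∉ T := ht
      rw [Set.indicator_of_notMem ht, Set.indicator_apply, Set.indicator_of_notMem h1, ite_self]
  have hmeas : AEMeasurable (Function.uncurry fun r t => T.indicator (fun x => G x.2) (r, t))
      (μ.prod μ) :=
    (hG.comp_snd).indicator hTm
  calc _ = ∫⁻ r, ENNReal.ofReal d⁻¹ * ∫⁻ t, T.indicator (fun x => G x.2) (r, t) ∂μ ∂μ := by
        refine setLIntegral_congr_fun measurableSet_Ioi fun r hr => ?_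
        simp only [e1 r hr]
    _ = ENNReal.ofReal d⁻¹ * ∫⁻ t, ∫⁻ r, T.indicator (fun x => G x.2) (r, t) ∂μ ∂μ := by
        rw [lintegral_const_mul' _ _ ENNReal.ofReal_ne_top, lintegral_lintegral_swap hmeas]
    _ ≤ ENNReal.ofReal d⁻¹ * ∫⁻ t, G t * ENNReal.ofReal d ∂μ := by
        gcongr with t
        calc ∫⁻ r, T.indicator (fun x => G x.2) (r, t) ∂μ
            ≤ ∫⁻ r, (Set.Ico (t - d) t).indicator (fun _ => G t) r := by
              refine (lintegral_mono' Measure.restrict_le_self le_rfl).trans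
                (lintegral_mono fun r => ?_)
              by_cases hr : (r, t) ∈ T
              · have h1 : r ∈ Set.Ico (t - d) t := ⟨by linarith [hr.2], hr.1⟩
                rw [Set.indicator_of_mem hr, Set.indicator_of_mem h1]
              · rw [Set.indicator_of_notMem hr]
                exact zero_le
          _ = G t * ENNReal.ofReal d := by
              rw [lintegral_indicator measurableSet_Ico, setLIntegral_const, Real.volume_Ico,
                _root_.sub_sub_cancel]
    _ = ∫⁻ t, G t ∂μ := by
        rw [lintegral_mul_const' _ _ ENNReal.ofReal_ne_top, mul_comm, mul_assoc,
          ← ENNReal.ofReal_mul hd.le, mul_inv_cancel₀ hd.ne', ENNReal.ofReal_one, mul_one]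

lemma MemX.lintegral_diffQuot_le (hp : 2 ≤ p) (hα : α = p - 1) (h : MemX p α θ u u') {d : ℝ}
    (hd : 0 < d) :
    wInt α (fun r => |d⁻¹ * (u (r + d) - u r)| ^ p) ≤ wInt α (fun r => |u' r| ^ p) := by
  unfold wInt
  gcongr 1
  refine le_trans (setLIntegral_mono' measurableSet_Ioi fun r hr => h.diffQuot_le hp hα hr hd)
    (lintegral_lintegral_Ioc_le ?_ hd)
  exact (aemeasurable_abs_rpow h.aemeasurable_deriv p).ennreal_ofReal.mul (by fun_prop)

end

section

variable {p α θ : ℝ} {k : ℕ} {u u' : ℝ → ℝ} {v v' : ℕ → ℝ → ℝ}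

lemma MemX.abs_sub_le_lintegral_uIoc (h : MemX p α θ u u') {s t : ℝ} (hs : 0 < s) (ht : 0 < t) :
    ENNReal.ofReal (dist (u s) (u t)) ≤ ∫⁻ r in Set.uIoc s t, ENNReal.ofReal |u' r| := by
  rw [Real.dist_eq]
  rcases le_total s t with hst | hst
  · rw [Set.uIoc_of_le hst, abs_sub_comm]
    exact h.abs_sub_le_lintegral hs hst
  · rw [Set.uIoc_of_ge hst]
    exact h.abs_sub_le_lintegral ht hst

lemma Admissible.sum_dist_le (hp : 2 ≤ p) (hα : α = p - 1) (h : Admissible p α θ u u') {a b : ℝ}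
    (ha : 0 < a) (hab : a ≤ b) {E : ℕ × (ℕ → ℝ × ℝ)}
    (hE : E ∈ AbsolutelyContinuousOnInterval.disjWithin a b) :
    ∑ i ∈ Finset.range E.1, dist (u (E.2 i).1) (u (E.2 i).2) ≤
      logConst p α * (a⁻¹ * ∑ i ∈ Finset.range E.1, dist (E.2 i).1 (E.2 i).2) ^ ((p - 1) / p) := by
  have hL := logConst_pos hp hα
  have hq : 0 ≤ (p - 1) / p := div_nonneg (by linarith) (by linarith)
  have hmem : ∀ i ∈ Finset.range E.1, a ≤ (E.2 i).1 ∧ a ≤ (E.2 i).2 := fun i hi => by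
    have := hE.1 i hi
    rw [Set.uIcc_of_le hab] at this
    exact ⟨this.1.1, this.2.1⟩
  set D := ∑ i ∈ Finset.range E.1, dist (E.2 i).1 (E.2 i).2 with hD
  have hD0 : 0 ≤ D := Finset.sum_nonneg fun _ _ => dist_nonneg
  set S := ⋃ i ∈ Finset.range E.1, Set.uIoc (E.2 i).1 (E.2 i).2 with hS
  have hSm : MeasurableSet S := Finset.measurableSet_biUnion _ fun _ _ => measurableSet_uIoc
  have hSa : ∀ x ∈ S, a < x := by
    intro x hx
    simp only [hS, Set.mem_iUnion] at hx
    obtain ⟨i, hi, hx⟩ := hx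
    exact (le_min (hmem i hi).1 (hmem i hi).2).trans_lt hx.1
  have hvol : volume S ≤ ENNReal.ofReal D := by
    refine (measure_biUnion_finset_le _ _).trans ?_
    rw [hD, ENNReal.ofReal_sum_of_nonneg fun _ _ => dist_nonneg]
    refine Finset.sum_le_sum fun i _ => ?_
    rw [Set.uIoc, Real.volume_Ioc, max_sub_min_eq_abs', Real.dist_eq]
  have hinv : ∫⁻ r in S, ENNReal.ofReal r⁻¹ ≤ ENNReal.ofReal (a⁻¹ * D) := by
    calc ∫⁻ r in S, ENNReal.ofReal r⁻¹ ≤ ∫⁻ _ in S, ENNReal.ofReal a⁻¹ := by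
          refine setLIntegral_mono' hSm fun x hx => ?_
          have := hSa x hx
          gcongr
      _ = ENNReal.ofReal a⁻¹ * volume S := setLIntegral_const _ _
      _ ≤ _ := by
          rw [ENNReal.ofReal_mul (by positivity)]
          gcongr
  rw [← ENNReal.ofReal_le_ofReal_iff (by positivity),
    ENNReal.ofReal_sum_of_nonneg fun _ _ => dist_nonneg]
  calc ∑ i ∈ Finset.range E.1, ENNReal.ofReal (dist (u (E.2 i).1) (u (E.2 i).2))
      ≤ ∑ i ∈ Finset.range E.1, ∫⁻ r in Set.uIoc (E.2 i).1 (E.2 i).2, ENNReal.ofReal |u' r| :=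
        Finset.sum_le_sum fun i hi => h.1.abs_sub_le_lintegral_uIoc
          (ha.trans_le (hmem i hi).1) (ha.trans_le (hmem i hi).2)
    _ = ∫⁻ r in S, ENNReal.ofReal |u' r| :=
        (lintegral_biUnion_finset hE.2 (fun _ _ => measurableSet_uIoc) _).symm
    _ ≤ ENNReal.ofReal (logConst p α) * (∫⁻ r in S, ENNReal.ofReal r⁻¹) ^ ((p - 1) / p) :=
        h.lintegral_deriv_le hp hα hSm fun x hx => ha.trans (hSa x hx)
    _ ≤ ENNReal.ofReal (logConst p α) * (ENNReal.ofReal (a⁻¹ * D)) ^ ((p - 1) / p) := by gcongr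
    _ = _ := by
        rw [ENNReal.ofReal_rpow_of_nonneg (by positivity) hq, ← ENNReal.ofReal_mul hL.le]

lemma absolutelyContinuousOnInterval_of_tendsto (hp : 2 ≤ p) (hα : α = p - 1)
    (hv : ∀ n, Admissible p α θ (v n) (v' n))
    (hlim : ∀ r, 0 < r → Tendsto (fun n => v n r) atTop (nhds (u r))) {a b : ℝ}
    (ha : 0 < a) (hab : a ≤ b) : AbsolutelyContinuousOnInterval u a b := by
  have hq : 0 < (p - 1) / p := div_pos (by linarith) (by linarith)
  have htot : Tendsto (fun E : ℕ × (ℕ → ℝ × ℝ) =>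
      logConst p α * (a⁻¹ * ∑ i ∈ Finset.range E.1, dist (E.2 i).1 (E.2 i).2) ^ ((p - 1) / p))
      (AbsolutelyContinuousOnInterval.totalLengthFilter ⊓
        𝓟 (AbsolutelyContinuousOnInterval.disjWithin a b)) (nhds 0) := by
    have h0 : Tendsto (fun x : ℝ => logConst p α * (a⁻¹ * x) ^ ((p - 1) / p)) (nhds 0)
        (nhds 0) := by
      have : Continuous fun x : ℝ => logConst p α * (a⁻¹ * x) ^ ((p - 1) / p) :=
        continuous_const.mul ((continuous_const.mul continuous_id).rpow_const
          fun _ => Or.inr hq.le)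
      simpa [Real.zero_rpow hq.ne'] using this.tendsto 0
    exact h0.comp (tendsto_comap.mono_left inf_le_left)
  refine squeeze_zero' (Eventually.of_forall fun E => Finset.sum_nonneg fun _ _ => dist_nonneg)
    ?_ htot
  refine eventually_inf_principal.2 (Eventually.of_forall fun E hE => ?_)
  refine le_of_tendsto (f := fun n => ∑ i ∈ Finset.range E.1, dist (v n (E.2 i).1) (v n (E.2 i).2))
    (x := atTop) (tendsto_finsetSum _ fun i hi => ?_)
    (Eventually.of_forall fun n => (hv n).sum_dist_le hp hα ha hab hE)
  have hi' := hE.1 i hi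
  rw [Set.uIcc_of_le hab] at hi'
  exact (hlim _ (ha.trans_le hi'.1.1)).dist (hlim _ (ha.trans_le hi'.2.1))

lemma wInt_le_of_tendsto {f : ℕ → ℝ → ℝ} {g : ℝ → ℝ} {b : ℕ → ℝ≥0∞} {c : ℝ≥0∞}
    (hf : ∀ n, AEMeasurable (f n) (volume.restrict (Set.Ioi 0)))
    (hfg : ∀ᵐ r ∂volume.restrict (Set.Ioi (0 : ℝ)), Tendsto (fun n => f n r) atTop (nhds (g r)))
    (hb : ∀ n, wInt θ (f n) ≤ b n) (hc : Tendsto b atTop (nhds c)) : wInt θ g ≤ c := by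
  have hm : ∀ n, AEMeasurable (fun r => ENNReal.ofReal (f n r) * ENNReal.ofReal (r ^ θ))
      (volume.restrict (Set.Ioi 0)) := fun n => (hf n).ennreal_ofReal.mul (by fun_prop)
  have h1 : ∫⁻ r in Set.Ioi (0 : ℝ), ENNReal.ofReal (g r) * ENNReal.ofReal (r ^ θ) ≤
      liminf (fun n => ∫⁻ r in Set.Ioi (0 : ℝ), ENNReal.ofReal (f n r) * ENNReal.ofReal (r ^ θ))
        atTop := by
    refine le_trans (lintegral_mono_ae ?_) (lintegral_liminf_le' hm)
    filter_upwards [hfg] with r hr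
    exact (ENNReal.Tendsto.mul_const (ENNReal.tendsto_ofReal hr)
      (Or.inr ENNReal.ofReal_ne_top)).liminf_eq.ge
  calc wInt θ g ≤ ENNReal.ofReal (omegaW θ) * liminf (fun n => ∫⁻ r in Set.Ioi (0 : ℝ),
        ENNReal.ofReal (f n r) * ENNReal.ofReal (r ^ θ)) atTop := by
        unfold wInt
        gcongr
    _ ≤ liminf b atTop := by
        rw [← ENNReal.liminf_const_mul_of_ne_top ENNReal.ofReal_ne_top]
        exact liminf_le_liminf (Eventually.of_forall hb)
    _ = c := hc.liminf_eq

lemma tendsto_abs_rpow (hp : 0 < p) {ι : Type*} {l : Filter ι} {f : ι → ℝ} {x : ℝ}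
    (h : Tendsto f l (nhds x)) : Tendsto (fun i => |f i| ^ p) l (nhds (|x| ^ p)) :=
  h.abs.rpow_const (Or.inr hp.le)

theorem memX_of_tendsto (hp : 2 ≤ p) (hα : α = p - 1) (hθ : 0 ≤ θ)
    (hv : ∀ n, Admissible p α θ (v n) (v' n))
    (hlim : ∀ r, 0 < r → Tendsto (fun n => v n r) atTop (nhds (u r))) {a b : ℝ≥0∞}
    (ha : Tendsto (fun n => wInt θ (fun r => |v n r| ^ p)) atTop (nhds a))
    (hb : Tendsto (fun n => wInt α (fun r => |v' n r| ^ p)) atTop (nhds b)) :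
    MemX p α θ u (deriv u) ∧ wInt θ (fun r => |u r| ^ p) ≤ a ∧
      wInt α (fun r => |deriv u r| ^ p) ≤ b := by
  have hp0 : 0 < p := by linarith
  have hAC := fun {x y : ℝ} (hx : 0 < x) (hxy : x ≤ y) =>
    absolutelyContinuousOnInterval_of_tendsto hp hα hv hlim hx hxy
  have hcont : ContinuousOn u (Set.Ioi 0) := by
    intro x hx
    have hx0 : (0 : ℝ) < x := hx
    have h1 := (hAC (show 0 < x / 2 by linarith) (show x / 2 ≤ 2 * x by linarith)).continuousOn
    rw [Set.uIcc_of_le (by linarith)] at h1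
    exact (h1.continuousAt (Icc_mem_nhds (by linarith) (by linarith))).continuousWithinAt
  have hdiff : ∀ᵐ r ∂volume.restrict (Set.Ioi (0 : ℝ)), DifferentiableAt ℝ u r := by
    have h1 : ∀ᵐ r, ∀ n : ℕ, r ∈ Set.uIcc (1 / ((n : ℝ) + 1)) ((n : ℝ) + 1) →
        DifferentiableAt ℝ u r := ae_all_iff.2 fun n => (hAC (by positivity) (by
          rw [div_le_iff₀ (by positivity)]
          nlinarith [(n.cast_nonneg : (0 : ℝ) ≤ n)])).ae_differentiableAt
    filter_upwards [ae_restrict_of_ae h1, ae_restrict_mem measurableSet_Ioi] with r hr hr0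
    have hr0' : (0 : ℝ) < r := hr0
    obtain ⟨n, hn⟩ := exists_nat_gt (max r r⁻¹)
    have h2 : r < n := (le_max_left _ _).trans_lt hn
    have h3 : r⁻¹ < n := (le_max_right _ _).trans_lt hn
    refine hr n (Set.Icc_subset_uIcc ⟨?_, by linarith⟩)
    rw [one_div]
    exact (inv_lt_of_inv_lt₀ hr0' (by linarith)).le
  have hum : AEMeasurable u (volume.restrict (Set.Ioi 0)) := hcont.aemeasurable measurableSet_Ioi
  have hA : wInt θ (fun r => |u r| ^ p) ≤ a := by
    refine wInt_le_of_tendsto (fun n => aemeasurable_abs_rpow (hv n).1.aemeasurable p) ?_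
      (fun n => le_rfl) ha
    filter_upwards [ae_restrict_mem measurableSet_Ioi] with r hr
    exact tendsto_abs_rpow hp0 (hlim r hr)
  have hshift : ∀ {w : ℝ → ℝ}, ContinuousOn w (Set.Ioi 0) → ∀ {d : ℝ}, 0 < d →
      AEMeasurable (fun r => |d⁻¹ * (w (r + d) - w r)| ^ p) (volume.restrict (Set.Ioi 0)) := by
    intro w hw d hd
    refine aemeasurable_abs_rpow (ContinuousOn.aemeasurable ?_ measurableSet_Ioi) p
    refine continuousOn_const.mul (ContinuousOn.sub (hw.comp (by fun_prop) fun r hr => ?_) hw)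
    exact add_pos hr hd
  have hBd : ∀ d : ℝ, 0 < d → wInt α (fun r => |d⁻¹ * (u (r + d) - u r)| ^ p) ≤ b := by
    intro d hd
    refine wInt_le_of_tendsto (fun n => hshift (hv n).1.continuousOn hd) ?_
      (fun n => (hv n).1.lintegral_diffQuot_le hp hα hd) hb
    filter_upwards [ae_restrict_mem measurableSet_Ioi] with r hr
    exact tendsto_abs_rpow hp0 (((hlim _ (add_pos hr hd)).sub (hlim r hr)).const_mul _)
  have hB : wInt α (fun r => |deriv u r| ^ p) ≤ b := by
    refine wInt_le_of_tendsto (f := fun n r => |(1 / ((n : ℝ) + 1))⁻¹ *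
      (u (r + 1 / ((n : ℝ) + 1)) - u r)| ^ p) (fun n => hshift hcont (by positivity)) ?_
      (fun n => hBd _ (by positivity)) tendsto_const_nhds
    filter_upwards [hdiff] with r hr
    refine tendsto_abs_rpow hp0 ?_
    have hs := hr.hasDerivAt.tendsto_slope_zero
    refine hs.comp (tendsto_nhdsWithin_iff.2 ⟨tendsto_one_div_add_atTop_nhds_zero_nat, ?_⟩)
    exact Eventually.of_forall fun n => (by positivity : (1 : ℝ) / ((n : ℝ) + 1) ≠ 0)
  have ha1 : a ≤ 1 := le_of_tendsto' ha fun n => (hv n).wInt_le_one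
  have hb1 : b ≤ 1 := le_of_tendsto' hb fun n => (hv n).wInt_deriv_le_one
  refine ⟨⟨fun x y hx hxy => (hAC hx hxy).intervalIntegrable_deriv,
    fun x y hx hxy => (hAC hx hxy).integral_deriv_eq_sub.symm, ?_, ?_, ?_⟩, hA, hB⟩
  · refine Metric.tendsto_atTop.2 fun ε hε => ?_
    obtain ⟨R, hR1, hR⟩ := exists_forall_admissible_abs_le hp hα hθ (half_pos hε)
    refine ⟨R, fun r hr => ?_⟩
    have := le_of_tendsto (hlim r (by linarith)).abs
      (Eventually.of_forall fun n => hR _ _ (hv n) r hr)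
    rw [dist_zero_right, Real.norm_eq_abs]
    linarith
  · rw [wNorm_lt_top_iff hp0]
    exact (hA.trans ha1).trans_lt ENNReal.one_lt_top
  · rw [wNorm_lt_top_iff hp0]
    exact (hB.trans hb1).trans_lt ENNReal.one_lt_top

end

section

variable {p α θ : ℝ} {k : ℕ} {u u' : ℝ → ℝ} {v v' : ℕ → ℝ → ℝ}

lemma cauchySeq_of_tendsto_rat (hp : 2 ≤ p) (hα : α = p - 1)
    (hv : ∀ n, Admissible p α θ (v n) (v' n))
    (hlim : ∀ q : ℚ, 0 < q → ∃ x, Tendsto (fun n => v n q) atTop (nhds x)) {r : ℝ} (hr : 0 < r) :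
    CauchySeq fun n => v n r := by
  have hq : 0 < (p - 1) / p := div_pos (by linarith) (by linarith)
  rw [Metric.cauchySeq_iff]
  intro ε hε
  have hcont : ContinuousAt (fun t : ℝ => logConst p α * Real.log (t / r) ^ ((p - 1) / p)) r := by
    refine ContinuousAt.mul continuousAt_const (ContinuousAt.rpow_const ?_ (Or.inr hq.le))
    exact ContinuousAt.log (by fun_prop) (by rw [div_self hr.ne']; norm_num)
  have h0 : logConst p α * Real.log (r / r) ^ ((p - 1) / p) < ε / 3 := by
    rw [div_self hr.ne', Real.log_one, Real.zero_rpow hq.ne', mul_zero]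
    positivity
  obtain ⟨δ, hδ, hball⟩ := Metric.eventually_nhds_iff.1 (hcont.eventually_lt_const h0)
  obtain ⟨q, hq1, hq2⟩ := exists_rat_btwn (show r < r + δ by linarith)
  have hq0 : (0 : ℝ) < q := hr.trans hq1
  have hqb := hball (y := (q : ℝ)) (by rw [Real.dist_eq, abs_of_pos (by linarith)]; linarith)
  obtain ⟨x, hx⟩ := hlim q (by exact_mod_cast hq0)
  obtain ⟨N, hN⟩ := Metric.cauchySeq_iff.1 hx.cauchySeq (ε / 3) (by positivity)
  refine ⟨N, fun m hm n hn => ?_⟩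
  have h1 := (hv m).abs_sub_le hp hα hr hq1.le
  have h2 := (hv n).abs_sub_le hp hα hr hq1.le
  have h3 := hN m hm n hn
  rw [Real.dist_eq] at h3 ⊢
  rw [abs_le] at h1 h2
  rw [abs_lt] at h3 ⊢
  constructor <;> linarith

lemma exists_subseq_tendsto (hp : 2 ≤ p) (hα : α = p - 1) (hθ : 0 ≤ θ)
    (hv : ∀ n, Admissible p α θ (v n) (v' n)) :
    ∃ (φ : ℕ → ℕ) (u : ℝ → ℝ) (a b : ℝ≥0∞), StrictMono φ ∧
      (∀ r, 0 < r → Tendsto (fun n => v (φ n) r) atTop (nhds (u r))) ∧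
      Tendsto (fun n => wInt θ fun r => |v (φ n) r| ^ p) atTop (nhds a) ∧
      Tendsto (fun n => wInt α fun r => |v' (φ n) r| ^ p) atTop (nhds b) := by
  choose M hM0 hM using fun q : {q : ℚ // 0 < q} =>
    exists_forall_admissible_abs_le_at (p := p) (α := α) (θ := θ) hp hα hθ
      (show (0 : ℝ) < q.1 by exact_mod_cast q.2)
  have hK : IsCompact ((Set.univ.pi fun q => Set.Icc (-M q) (M q)) ×ˢ
      (Set.univ : Set (ℝ≥0∞ × ℝ≥0∞))) :=
    (isCompact_univ_pi fun _ => isCompact_Icc).prod isCompact_univ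
  obtain ⟨x, -, φ, hφ, hx⟩ := hK.tendsto_subseq
    (x := fun n => (fun q : {q : ℚ // 0 < q} => v n q.1,
      (wInt θ fun r => |v n r| ^ p, wInt α fun r => |v' n r| ^ p)))
    fun n => ⟨fun q _ => abs_le.1 (hM q _ _ (hv n)), Set.mem_univ _⟩
  obtain ⟨hx1, hx2⟩ := Prod.tendsto_iff _ _ |>.1 hx
  obtain ⟨hx2, hx3⟩ := Prod.tendsto_iff _ _ |>.1 hx2
  have hc : ∀ r : ℝ, ∃ y, 0 < r → Tendsto (fun n => v (φ n) r) atTop (nhds y) := by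
    intro r
    by_cases hr : 0 < r
    · obtain ⟨y, hy⟩ := cauchySeq_tendsto_of_complete
        (cauchySeq_of_tendsto_rat hp hα (fun n => hv (φ n))
          (fun q hq => ⟨_, tendsto_pi_nhds.1 hx1 ⟨q, hq⟩⟩) hr)
      exact ⟨y, fun _ => hy⟩
    · exact ⟨0, fun h => absurd h hr⟩
  choose u hu using hc
  exact ⟨φ, u, _, _, hφ, hu, hx2, hx3⟩

lemma exists_maximizing_seq (hp : 0 < p) {σ : ℝ} (h0 : 0 < TMC p α θ σ) :
    ∃ v v' : ℕ → ℝ → ℝ, (∀ n, Admissible p α θ (v n) (v' n)) ∧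
      Tendsto (fun n => TMfunc p θ σ (v n)) atTop (nhds (TMC p α θ σ)) := by
  obtain ⟨l, -, hl, hlT⟩ := exists_seq_strictMono_tendsto' h0
  have : ∀ n, ∃ u u', Admissible p α θ u u' ∧ l n < TMfunc p θ σ u := by
    intro n
    have := (hl n).2
    rw [TMC_eq_iSup hp] at this
    simpa only [lt_iSup_iff, exists_prop] using this
  choose v v' hv hlv using this
  exact ⟨v, v', hv, tendsto_of_tendsto_of_tendsto_of_le_of_le hlT tendsto_const_nhds
    (fun n => (hlv n).le) fun n => (hv n).TMfunc_le hp⟩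

theorem tmcAttained_of_lt (hp : 2 ≤ p) (hα : α = p - 1) (hθ : 0 ≤ θ) (hk : (k : ℝ) = p - 1)
    {σ : ℝ} (hσ : 0 < σ) (hσμ : σ < muC α θ)
    (hlt : ENNReal.ofReal (σ ^ (p - 1) / (Nat.factorial k : ℝ)) < TMC p α θ σ) :
    TMCAttained p α θ σ := by
  have hp0 : 0 < p := by linarith
  obtain ⟨v₀, v₀', hv₀, hT₀⟩ := exists_maximizing_seq hp0 (pos_of_gt hlt)
  obtain ⟨φ, u, a, b, hφ, hlim, ha, hb⟩ := exists_subseq_tendsto hp hα hθ hv₀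
  have hv := fun n => hv₀ (φ n)
  obtain ⟨hu, hua, hub⟩ := memX_of_tendsto hp hα hθ hv hlim ha hb
  have hle := le_add_TMhigh_of_tendsto hp hα hθ hk hσ.le hσμ hv hlim ha
    (hT₀.comp hφ.tendsto_atTop)
  have hab : a + b ≤ 1 := le_of_tendsto' (ha.add hb) fun n => (hv n).2
  have ha1 : a ≤ 1 := le_self_add.trans hab
  set A := wInt θ (fun r => |u r| ^ p) with hA
  have hA0 : A ≠ 0 := by
    intro h0
    rw [(TMhigh_eq_zero_iff (k := k) hp hθ hσ hu.aemeasurable).2 h0, add_zero] at hle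
    exact absurd (hle.trans ((mul_le_mul_right ha1 _).trans_eq (mul_one _))) (not_le.2 hlt)
  have haT : a ≠ ⊤ := (ha1.trans_lt ENNReal.one_lt_top).ne
  have hAT : A ≠ ⊤ := (hua.trans_lt haT.lt_top).ne
  have hA' : 0 < A.toReal := ENNReal.toReal_pos hA0 hAT
  have hAa : A.toReal ≤ a.toReal := ENNReal.toReal_mono haT hua
  have ha' : 0 < a.toReal := hA'.trans_le hAa
  set Q := a.toReal / A.toReal with hQ
  have hQ1 : 1 ≤ Q := (one_le_div hA').2 hAa
  have hQ0 : 0 < Q := by linarith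
  set c := Q ^ (-(θ + 1)⁻¹) with hc
  have hc0 : 0 < c := by positivity
  have hcQ : c ^ (-(θ + 1)) = Q := by
    rw [hc, ← Real.rpow_mul hQ0.le, neg_mul_neg, inv_mul_cancel₀ (by positivity), Real.rpow_one]
  have hwA : wInt θ (fun r => |1 * u (c * r)| ^ p) = a := by
    rw [wInt_scale hc0, hcQ, ← hA, ← ENNReal.ofReal_toReal hAT,
      ← ENNReal.ofReal_mul (by positivity), abs_one, Real.one_rpow, one_mul, hQ,
      div_mul_cancel₀ _ hA'.ne', ENNReal.ofReal_toReal haT]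
  have hadm : Admissible p α θ (fun r => 1 * u (c * r)) (fun r => 1 * c * deriv u (c * r)) := by
    refine ⟨hu.scale hp0 hα 1 hc0, ?_⟩
    rw [hwA, wInt_deriv_scale hα hc0, abs_one, Real.one_rpow, ENNReal.ofReal_one, one_mul]
    exact (add_le_add_right hub a).trans hab
  refine (TMCAttained_iff hp0 α θ σ).2 ⟨_, _, hadm, le_antisymm ?_ (hadm.TMfunc_le hp0)⟩
  rw [TMfunc_eq_add hp hk hσ.le hadm.1.aemeasurable, hwA]
  refine hle.trans (add_le_add_right ?_ _)
  have hH : TMhigh p θ k σ (fun r => 1 * u (c * r)) = ENNReal.ofReal Q * TMhigh p θ k σ u := by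
    unfold TMhigh
    simp only [one_mul]
    rw [wInt_comp_mul hc0 (fun r => expTail (k + 1) (σ * |u r| ^ (p / (p - 1)))), hcQ]
  rw [hH]
  exact le_mul_of_one_le_left' (ENNReal.one_le_ofReal.2 hQ1)

end

section

variable {p α θ : ℝ} {k : ℕ} {u u' : ℝ → ℝ}

lemma TMC_zero (hp : 2 ≤ p) (hk : (k : ℝ) = p - 1) : TMC p α θ 0 = 0 := by
  refine le_antisymm (TMC_le (by linarith) fun u u' hu => ?_) zero_le
  have h0 : expTail (k + 1) 0 = 0 := by
    simp [expTail, Finset.sum_range_succ']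
  rw [TMfunc_eq_add hp hk le_rfl hu.1.aemeasurable]
  simp [TMhigh, h0, Real.zero_rpow (show p - 1 ≠ 0 by linarith), wInt]

lemma TMC_eq_of_not_attained (hp : 2 ≤ p) (hα : α = p - 1) (hθ : 0 ≤ θ) (hk : (k : ℝ) = p - 1)
    {σ : ℝ} (hσ : 0 < σ) (hσμ : σ < muC α θ) (h : ¬ TMCAttained p α θ σ) :
    TMC p α θ σ = ENNReal.ofReal (σ ^ (p - 1) / (Nat.factorial k : ℝ)) :=
  le_antisymm (not_lt.1 fun hlt => h (tmcAttained_of_lt hp hα hθ hk hσ hσμ hlt))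
    (ofReal_le_TMC hp hα hθ hk hσ.le)

lemma TMC_le_of_forall_lt (hp : 2 ≤ p) (hk : (k : ℝ) = p - 1) {σ : ℝ} (hσ : 0 < σ)
    (h : ∀ s, 0 < s → s < σ → TMC p α θ s ≤ ENNReal.ofReal (s ^ (p - 1) / (Nat.factorial k : ℝ))) :
    TMC p α θ σ ≤ ENNReal.ofReal (σ ^ (p - 1) / (Nat.factorial k : ℝ)) := by
  have hs : Tendsto (fun n : ℕ => σ * (1 - 1 / ((n + 1 : ℕ) + 1 : ℝ))) atTop (nhds σ) := by
    have := ((tendsto_one_div_add_atTop_nhds_zero_nat (𝕜 := ℝ)).comp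
      (tendsto_add_atTop_nat 1)).const_sub 1 |>.const_mul σ
    simpa using this
  have hpos : ∀ n : ℕ, 0 < σ * (1 - 1 / ((n + 1 : ℕ) + 1 : ℝ)) ∧
      σ * (1 - 1 / ((n + 1 : ℕ) + 1 : ℝ)) < σ := by
    intro n
    have h1 : (0 : ℝ) < 1 / ((n + 1 : ℕ) + 1 : ℝ) := by positivity
    have h2 : 1 / ((n + 1 : ℕ) + 1 : ℝ) < 1 := by
      rw [div_lt_one (by positivity)]
      have : (0 : ℝ) < (n + 1 : ℕ) := by positivity
      linarith
    constructor <;> nlinarith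
  refine TMC_le (by linarith) fun u u' hu => ?_
  refine wInt_le_of_tendsto (f := fun (n : ℕ) r => phiP p
      (σ * (1 - 1 / ((n + 1 : ℕ) + 1 : ℝ)) * |u r| ^ (p / (p - 1)))) (fun n => ?_)
    (ae_of_all _ fun r => ?_)
    (fun n => (hu.TMfunc_le (by linarith)).trans (h _ (hpos n).1 (hpos n).2)) ?_
  · simp only [phiP_eq_expTail hk]
    exact (continuous_expTail k).measurable.comp_aemeasurable
      ((aemeasurable_abs_rpow hu.1.aemeasurable _).const_mul _)
  · simp only [phiP_eq_expTail hk]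
    exact ((continuous_expTail k).tendsto _).comp (hs.mul_const _)
  · exact ENNReal.tendsto_ofReal ((hs.rpow_const (Or.inl hσ.ne')).div_const _)

lemma mul_TMC_lt_TMC (hp : 2 ≤ p) (hα : α = p - 1) (hθ : 0 ≤ θ) (hk : (k : ℝ) = p - 1)
    {σ₁ σ₂ : ℝ} (h₁ : 0 < σ₁) (h₁₂ : σ₁ < σ₂) (h₂ : σ₂ < muC α θ) (h : TMCAttained p α θ σ₁) :
    ENNReal.ofReal ((σ₂ / σ₁) ^ (p - 1)) * TMC p α θ σ₁ < TMC p α θ σ₂ := by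
  have hp0 : 0 < p := by linarith
  obtain ⟨u, u', hu, hT⟩ := (TMCAttained_iff hp0 α θ σ₁).1 h
  have hρ : 1 < σ₂ / σ₁ := (one_lt_div h₁).2 h₁₂
  have hρ0 : 0 < σ₂ / σ₁ := by linarith
  have hσ₂ : σ₂ / σ₁ * σ₁ = σ₂ := div_mul_cancel₀ _ h₁.ne'
  have hc1 : ENNReal.ofReal (σ₁ ^ (p - 1) / (Nat.factorial k : ℝ)) ≤ TMC p α θ σ₁ :=
    ofReal_le_TMC hp hα hθ hk h₁.le
  have hc1pos : 0 < ENNReal.ofReal (σ₁ ^ (p - 1) / (Nat.factorial k : ℝ)) := by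
    rw [ENNReal.ofReal_pos]
    positivity
  have hfin := TMC_lt_top hp hα hθ hk h₁.le (h₁₂.trans h₂)
  have hle2 := hu.TMfunc_le (σ := σ₂) hp0
  have hH := mul_TMhigh_le (p := p) (θ := θ) (k := k) (u := u) h₁.le hρ.le
  rw [hσ₂] at hH
  rw [TMfunc_eq_add hp hk (h₁.trans h₁₂).le hu.1.aemeasurable] at hle2
  rw [TMfunc_eq_add hp hk h₁.le hu.1.aemeasurable] at hT
  set A := wInt θ (fun r => |u r| ^ p) with hA
  have hA1 : A ≤ 1 := hu.wInt_le_one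
  have hH0 : TMhigh p θ k σ₁ u ≠ 0 := by
    intro h0
    have hA0 := (TMhigh_eq_zero_iff hp hθ h₁ hu.1.aemeasurable).1 h0
    rw [h0, hA, hA0, mul_zero, add_zero] at hT
    rw [hT] at hc1
    exact absurd hc1 (not_le.2 hc1pos)
  have hHT : TMhigh p θ k σ₁ u ≠ ⊤ :=
    ((le_add_self.trans_eq hT.symm).trans_lt hfin).ne
  have hc2 : ENNReal.ofReal ((σ₂ / σ₁) ^ (p - 1)) *
      ENNReal.ofReal (σ₁ ^ (p - 1) / (Nat.factorial k : ℝ)) =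
      ENNReal.ofReal (σ₂ ^ (p - 1) / (Nat.factorial k : ℝ)) := by
    rw [← ENNReal.ofReal_mul (by positivity), ← mul_div_assoc, ← Real.mul_rpow hρ0.le h₁.le, hσ₂]
  have hpow : (σ₂ / σ₁) ^ (p - 1) < (σ₂ / σ₁) ^ (k + 1) := by
    rw [← hk, Real.rpow_natCast]
    exact pow_lt_pow_right₀ hρ (Nat.lt_succ_self k)
  rw [hT, mul_add, ← mul_assoc, hc2]
  refine lt_of_lt_of_le ?_ ((add_le_add_right hH _).trans hle2)
  refine ENNReal.add_lt_add_left
    (ENNReal.mul_lt_top ENNReal.ofReal_lt_top (hA1.trans_lt ENNReal.one_lt_top)).ne ?_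
  have hlt : ENNReal.ofReal ((σ₂ / σ₁) ^ (p - 1)) < ENNReal.ofReal ((σ₂ / σ₁) ^ (k + 1)) :=
    (ENNReal.ofReal_lt_ofReal_iff (by positivity)).2 hpow
  exact (ENNReal.mul_lt_mul_iff_left hH0 hHT).2 hlt

end

theorem stmt_10 (p α θ : ℝ) (hp : 2 ≤ p) (hα : α = p - 1) (hθ : 0 ≤ θ)
    (hk : (k0 p : ℝ) = p - 1)
    (hne : {σ : ℝ | σ ∈ Set.Ioo 0 (muC α θ) ∧ TMCAttained p α θ σ}.Nonempty)
    (hlt : sigmaStar p α θ < muC α θ) :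
    StrictMonoOn
      (fun σ : ℝ => ENNReal.ofReal ((Nat.factorial (k0 p) : ℝ) / σ ^ (p - 1)) * TMC p α θ σ)
      (Set.Ioo (sigmaStar p α θ) (muC α θ)) ∧
    (∀ σ : ℝ, σ ∈ Set.Icc 0 (sigmaStar p α θ) →
      TMC p α θ σ = ENNReal.ofReal (σ ^ (p - 1) / (Nat.factorial (k0 p) : ℝ))) ∧
    (∀ σ : ℝ, σ ∈ Set.Ioo (sigmaStar p α θ) (muC α θ) →
      ENNReal.ofReal (σ ^ (p - 1) / (Nat.factorial (k0 p) : ℝ)) < TMC p α θ σ) ∧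
    sigmaStar p α θ = sInf {σ : ℝ | σ ∈ Set.Ioo 0 (muC α θ) ∧
      ENNReal.ofReal (σ ^ (p - 1) / (Nat.factorial (k0 p) : ℝ)) < TMC p α θ σ} := by
  set s := sigmaStar p α θ with hs
  have hs0 : 0 ≤ s := Real.sInf_nonneg fun σ hσ => hσ.1.1.le
  have hbdd : BddBelow {σ : ℝ | σ ∈ Set.Ioo 0 (muC α θ) ∧ TMCAttained p α θ σ} :=
    ⟨0, fun σ hσ => hσ.1.1.le⟩
  have hgt : ∀ σ : ℝ, σ ∈ Set.Ioo s (muC α θ) →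
      ENNReal.ofReal (σ ^ (p - 1) / (Nat.factorial (k0 p) : ℝ)) < TMC p α θ σ := by
    rintro σ ⟨h1, h2⟩
    obtain ⟨σ₁, ⟨⟨h3, h4⟩, hatt⟩, h5⟩ := exists_lt_of_csInf_lt hne h1
    refine lt_of_le_of_lt ?_ (mul_TMC_lt_TMC hp hα hθ hk h3 h5 h2 hatt)
    have hσ : 0 < σ / σ₁ := div_pos (h3.trans h5) h3
    have hσ' : σ / σ₁ * σ₁ = σ := div_mul_cancel₀ _ h3.ne'
    calc ENNReal.ofReal (σ ^ (p - 1) / (Nat.factorial (k0 p) : ℝ))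
        = ENNReal.ofReal ((σ / σ₁) ^ (p - 1)) *
          ENNReal.ofReal (σ₁ ^ (p - 1) / (Nat.factorial (k0 p) : ℝ)) := by
          rw [← ENNReal.ofReal_mul (by positivity), ← mul_div_assoc,
            ← Real.mul_rpow hσ.le h3.le, hσ']
      _ ≤ _ := by
          gcongr
          exact ofReal_le_TMC hp hα hθ hk h3.le
  have heq_lt : ∀ σ, 0 < σ → σ < s →
      TMC p α θ σ = ENNReal.ofReal (σ ^ (p - 1) / (Nat.factorial (k0 p) : ℝ)) :=
    fun σ h0 h1 => TMC_eq_of_not_attained hp hα hθ hk h0 (h1.trans hlt) fun hatt =>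
      absurd (csInf_le hbdd ⟨⟨h0, h1.trans hlt⟩, hatt⟩) (not_le.2 h1)
  have heq : ∀ σ : ℝ, σ ∈ Set.Icc 0 s →
      TMC p α θ σ = ENNReal.ofReal (σ ^ (p - 1) / (Nat.factorial (k0 p) : ℝ)) := by
    rintro σ ⟨h0, h1⟩
    rcases h0.eq_or_lt with rfl | h0
    · rw [TMC_zero hp hk, Real.zero_rpow (by linarith), zero_div, ENNReal.ofReal_zero]
    rcases h1.eq_or_lt with rfl | h1
    · exact le_antisymm (TMC_le_of_forall_lt hp hk h0 fun t ht0 hts => (heq_lt t ht0 hts).le)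
        (ofReal_le_TMC hp hα hθ hk h0.le)
    · exact heq_lt σ h0 h1
  refine ⟨fun σ₁ h₁ σ₂ h₂ h₁₂ => ?_, heq, hgt, ?_⟩
  · have h0 : 0 < σ₁ := hs0.trans_lt h₁.1
    have h0' : 0 < σ₂ := h0.trans h₁₂
    have hatt := tmcAttained_of_lt hp hα hθ hk h0 h₁.2 (hgt σ₁ h₁)
    have hlt' := mul_TMC_lt_TMC hp hα hθ hk h0 h₁₂ h₂.2 hatt
    have hfac : ENNReal.ofReal ((Nat.factorial (k0 p) : ℝ) / σ₁ ^ (p - 1)) =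
        ENNReal.ofReal ((Nat.factorial (k0 p) : ℝ) / σ₂ ^ (p - 1)) *
          ENNReal.ofReal ((σ₂ / σ₁) ^ (p - 1)) := by
      rw [← ENNReal.ofReal_mul (by positivity), Real.div_rpow h0'.le h0.le]
      congr 1
      have : σ₂ ^ (p - 1) ≠ 0 := by positivity
      field_simp
    change ENNReal.ofReal ((Nat.factorial (k0 p) : ℝ) / σ₁ ^ (p - 1)) * TMC p α θ σ₁ <
      ENNReal.ofReal ((Nat.factorial (k0 p) : ℝ) / σ₂ ^ (p - 1)) * TMC p α θ σ₂
    rw [hfac, mul_assoc]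
    refine (ENNReal.mul_lt_mul_iff_right ?_ ENNReal.ofReal_ne_top).2 hlt'
    rw [Ne, ENNReal.ofReal_eq_zero, not_le]
    positivity
  · have hset : {σ : ℝ | σ ∈ Set.Ioo 0 (muC α θ) ∧
        ENNReal.ofReal (σ ^ (p - 1) / (Nat.factorial (k0 p) : ℝ)) < TMC p α θ σ} =
        Set.Ioo s (muC α θ) := by
      ext σ
      refine ⟨fun ⟨⟨h0, h1⟩, h2⟩ => ⟨?_, h1⟩, fun h => ⟨⟨hs0.trans_lt h.1, h.2⟩, hgt σ h⟩⟩
      by_contra hle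
      exact absurd (heq σ ⟨h0.le, not_lt.1 hle⟩) h2.ne'
    rw [hset, csInf_Ioo hlt]
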